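/- arXiv:2403.04907 — 2 statements merged into one kernel-verified Lean document; each statement's English description precedes it below -/
import Mathlib

section
/- Assume there are random variables C₀,…,C₄ with Cᵢ ∈ L^{pᵢ} (pᵢ > 0, i = 0,…,4), A, B ∈ L^{p₅} (p₅ > 0), β > 1, and for each ε ∈ I a full-measure set Ω_ε ⊆ Ω such that conditions (C1)–(C6) hold with Ω′ replaced by Ω_ε (where in (C4) the inequality ‖L̂_ω h‖_s ≤ C₃(ω)‖h‖_ss holds for ℙ-a.e. ω, in (C5) additionally h_{ω,ε} ≥ 0 m-a.e., and (C6) holds for ℙ-a.e. ω). Let Φ : Ω × M → ℝ be measurable with Φ(ω,·) ∈ L^{∞}(m) for a.e. ω and G(ω) := ‖Φ(ω,·)‖_{L^{∞}(m)} ∈ L^{p₆} for some p₆ > 0 satisfying 1/p₆ + 1/p₁ + 1/p₃ + 1/p₄ ≤ 1 and 1/p₆ + 1/p₀ + 1/p₂ + 2/p₅ + 1/p₃ + 1/p₄ ≤ 1. Then the function ε ↦ ∫_Ω ∫_M Φ(ω,x)·h_{ω,ε}(x) dm(x) dℙ(ω) is differentiable at ε = 0. -/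
open MeasureTheory

noncomputable section

/-- `C ∈ L^p(Ω,𝓕,ℙ)` for a nonnegative random variable `C`. -/
def MemLpRV {Ω : Type*} [MeasurableSpace Ω] (ℙ : Measure Ω) (p : ℝ) (C : Ω → ℝ) : Prop :=
  Measurable C ∧ (∀ ω, 0 ≤ C ω) ∧ Integrable (fun ω => C ω ^ p) ℙ

/-- The cocycle `L^n_ω = L_{σ^{n-1}ω} ∘ ⋯ ∘ L_ω` (with `L⁰ = Id`). -/
def iterOp {Ω E : Type*} [NormedAddCommGroup E] [NormedSpace ℝ E]
    (σ : Ω → Ω) (L : Ω → E →L[ℝ] E) : ℕ → Ω → E →L[ℝ] E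
  | 0, _ => ContinuousLinearMap.id ℝ E
  | n + 1, ω => (iterOp σ L n (σ ω)).comp (L ω)

section helpers

open Filter Topology

/-- `f` is integrable with integral at most `K`. -/
def IntLe {Ω : Type*} [MeasurableSpace Ω] (ℙ : Measure Ω) (f : Ω → ℝ) (K : ℝ) : Prop :=
  Integrable f ℙ ∧ ∫ ω, f ω ∂ℙ ≤ K

theorem IntLe.add {Ω : Type*} [MeasurableSpace Ω] {ℙ : Measure Ω} {f g : Ω → ℝ} {K K' : ℝ}
    (hf : IntLe ℙ f K) (hg : IntLe ℙ g K') : IntLe ℙ (fun ω => f ω + g ω) (K + K') := by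
  refine ⟨hf.1.add hg.1, ?_⟩
  rw [integral_add hf.1 hg.1]
  exact add_le_add hf.2 hg.2

theorem IntLe.const_mul {Ω : Type*} [MeasurableSpace Ω] {ℙ : Measure Ω} {f : Ω → ℝ} {K : ℝ}
    (hf : IntLe ℙ f K) {c : ℝ} (hc : 0 ≤ c) : IntLe ℙ (fun ω => c * f ω) (c * K) := by
  refine ⟨hf.1.const_mul c, ?_⟩
  rw [integral_const_mul]
  exact mul_le_mul_of_nonneg_left hf.2 hc

theorem IntLe.sum {Ω ι : Type*} [MeasurableSpace Ω] {ℙ : Measure Ω} {s : Finset ι}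
    {f : ι → Ω → ℝ} {K : ι → ℝ}
    (hf : ∀ i ∈ s, IntLe ℙ (f i) (K i)) :
    IntLe ℙ (fun ω => ∑ i ∈ s, f i ω) (∑ i ∈ s, K i) := by
  refine ⟨integrable_finsetSum _ fun i hi => (hf i hi).1, ?_⟩
  rw [integral_finsetSum _ fun i hi => (hf i hi).1]
  exact Finset.sum_le_sum fun i hi => (hf i hi).2

theorem young_prod {ι : Type*} [Fintype ι] (x p : ι → ℝ) (hx : ∀ i, 0 ≤ x i)
    (hp : ∀ i, 0 < p i) (hs : ∑ i, 1 / p i ≤ 1) :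
    ∏ i, x i ≤ ∑ i, (1 / p i) * x i ^ p i + 1 := by
  have := Real.geom_mean_le_arith_mean_weighted (Finset.univ : Finset (Option ι))
    (fun o => o.elim (1 - ∑ i, 1 / p i) (fun i => 1 / p i))
    (fun o => o.elim 1 (fun i => x i ^ p i))
    (by
      rintro (_ | i) _
      · simpa using hs
      · exact (one_div_pos.2 (hp i)).le)
    (by simp [Fintype.sum_option])
    (by
      rintro (_ | i) _
      · simp
      · exact Real.rpow_nonneg (hx i) _)
  simp only [Fintype.prod_option, Fintype.sum_option, Option.elim, Real.one_rpow, one_mul,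
    mul_one] at this
  have h2 : ∀ i, (x i ^ p i) ^ (1 / p i) = x i := fun i => by
    rw [← Real.rpow_mul (hx i), mul_one_div_cancel (hp i).ne', Real.rpow_one]
  simp only [h2] at this
  have h3 : 0 ≤ ∑ i, 1 / p i := Finset.sum_nonneg fun i _ => (one_div_pos.2 (hp i)).le
  linarith

theorem holder_bound {Ω ι : Type*} [MeasurableSpace Ω] (ℙ : Measure Ω) [IsProbabilityMeasure ℙ]
    [Fintype ι] (X : ι → Ω → ℝ) (p : ι → ℝ) (hp : ∀ i, 0 < p i) (hs : ∑ i, 1 / p i ≤ 1)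
    (hX : ∀ i, MemLpRV ℙ (p i) (X i)) :
    ∃ K : ℝ, 0 ≤ K ∧ ∀ τ : ι → Ω → Ω, (∀ i, MeasurePreserving (τ i) ℙ ℙ) →
      IntLe ℙ (fun ω => ∏ i, X i (τ i ω)) K := by
  refine ⟨∑ i, (1 / p i) * ∫ ω, X i ω ^ p i ∂ℙ + 1, ?_, ?_⟩
  · refine add_nonneg (Finset.sum_nonneg fun i _ => ?_) zero_le_one
    exact mul_nonneg (one_div_pos.2 (hp i)).le
      (integral_nonneg fun ω => Real.rpow_nonneg ((hX i).2.1 ω) _)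
  · intro τ hτ
    have hi : ∀ i, IntLe ℙ (fun ω => X i (τ i ω) ^ p i) (∫ ω, X i ω ^ p i ∂ℙ) := by
      intro i
      have h1 : Integrable (fun ω => X i (τ i ω) ^ p i) ℙ :=
        (hτ i).integrable_comp_of_integrable (hX i).2.2
      refine ⟨h1, le_of_eq ?_⟩
      have h2 := integral_map (μ := ℙ) (hτ i).measurable.aemeasurable
        (f := fun ω => X i ω ^ p i) (by rw [(hτ i).map_eq]; exact (hX i).2.2.1)
      rw [(hτ i).map_eq] at h2
      exact h2.symm
    have hsum : IntLe ℙ (fun ω => ∑ i, (1 / p i) * X i (τ i ω) ^ p i + 1)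
        (∑ i, (1 / p i) * ∫ ω, X i ω ^ p i ∂ℙ + 1) := by
      refine (IntLe.sum fun i _ => (hi i).const_mul (one_div_pos.2 (hp i)).le).add ⟨?_, ?_⟩
      · exact integrable_const _
      · simp
    have hle : ∀ ω, ∏ i, X i (τ i ω) ≤ ∑ i, (1 / p i) * X i (τ i ω) ^ p i + 1 := fun ω =>
      young_prod _ _ (fun i => (hX i).2.1 _) hp hs
    have hinteg : Integrable (fun ω => ∏ i, X i (τ i ω)) ℙ := by
      refine hsum.1.mono' ?_ ?_
      · exact (Finset.measurable_prod _ fun i _ =>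
          (hX i).1.comp (hτ i).measurable).aestronglyMeasurable
      · refine Eventually.of_forall fun ω => ?_
        rw [Real.norm_of_nonneg (Finset.prod_nonneg fun i _ => (hX i).2.1 _)]
        exact hle ω
    exact ⟨hinteg, (integral_mono hinteg hsum.1 hle).trans hsum.2⟩

theorem MemLpRV.add_one {Ω : Type*} [MeasurableSpace Ω] {ℙ : Measure Ω} [IsProbabilityMeasure ℙ]
    {p : ℝ} (hp : 0 < p) {C : Ω → ℝ} (hC : MemLpRV ℙ p C) :
    MemLpRV ℙ p (fun ω => C ω + 1) := by
  obtain ⟨hm, h0, hi⟩ := hC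
  refine ⟨hm.add_const 1, fun ω => by linarith [h0 ω], ?_⟩
  refine ((hi.add (integrable_const (1 : ℝ))).const_mul ((2 : ℝ) ^ p)).mono' ?_ ?_
  · exact ((hm.add_const 1).pow_const p).aestronglyMeasurable
  · refine Eventually.of_forall fun ω => ?_
    have h := h0 ω
    rw [Real.norm_of_nonneg (Real.rpow_nonneg (by linarith) _)]
    simp only [Pi.add_apply]
    rcases le_total (C ω) 1 with h1 | h1
    · have : (C ω + 1) ^ p ≤ 2 ^ p := Real.rpow_le_rpow (by linarith) (by linarith) hp.le
      have h3 : 0 ≤ C ω ^ p := Real.rpow_nonneg h _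
      have h4 : (0 : ℝ) ≤ 2 ^ p := by positivity
      nlinarith [mul_nonneg h4 h3]
    · have : (C ω + 1) ^ p ≤ (2 * C ω) ^ p := Real.rpow_le_rpow (by linarith) (by linarith) hp.le
      rw [Real.mul_rpow (by norm_num) h] at this
      have h4 : (0 : ℝ) ≤ 2 ^ p := by positivity
      nlinarith

theorem meas_pairing_set {Ω M : Type*} [MeasurableSpace Ω] [MeasurableSpace M] (m : Measure M)
    (H : Ω → M → ℝ) (hH : ∀ ω, Integrable (H ω) m)
    (hHm : ∀ t : Set M, MeasurableSet t → Measurable fun ω => ∫ x in t, H ω x ∂m)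
    (s : Set (Ω × M)) (hs : MeasurableSet s) :
    Measurable fun ω => ∫ x in {x | (ω, x) ∈ s}, H ω x ∂m := by
  induction s, hs using MeasurableSpace.induction_on_inter generateFrom_prod.symm
    isPiSystem_prod with
  | empty => simp
  | basic t ht =>
    obtain ⟨a, ha, b, hb, rfl⟩ := ht
    have : (fun ω => ∫ x in {x | (ω, x) ∈ a ×ˢ b}, H ω x ∂m)
        = a.indicator (fun ω => ∫ x in b, H ω x ∂m) := by
      ext ω
      by_cases h : ω ∈ a <;> simp [h]
    change Measurable (fun ω => ∫ x in {x | (ω, x) ∈ a ×ˢ b}, H ω x ∂m)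
    rw [this]
    exact (hHm b hb).indicator ha
  | compl t ht ih =>
    have : (fun ω => ∫ x in {x | (ω, x) ∈ tᶜ}, H ω x ∂m)
        = fun ω => ∫ x in Set.univ, H ω x ∂m - ∫ x in {x | (ω, x) ∈ t}, H ω x ∂m := by
      ext ω
      have h1 : MeasurableSet {x | (ω, x) ∈ t} := measurable_prodMk_left ht
      rw [setIntegral_univ, ← integral_add_compl h1 (hH ω)]
      have : {x | (ω, x) ∈ tᶜ} = {x | (ω, x) ∈ t}ᶜ := rfl
      rw [this]; ring
    rw [this]
    exact (hHm _ MeasurableSet.univ).sub ih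
  | iUnion f hd hf ih =>
    have : ∀ ω, HasSum (fun n => ∫ x in {x | (ω, x) ∈ f n}, H ω x ∂m)
        (∫ x in {x | (ω, x) ∈ ⋃ i, f i}, H ω x ∂m) := by
      intro ω
      have h1 : {x | (ω, x) ∈ ⋃ i, f i} = ⋃ i, {x | (ω, x) ∈ f i} := by ext; simp
      rw [h1]
      refine hasSum_integral_iUnion (fun i => measurable_prodMk_left (hf i)) ?_
        (hH ω).integrableOn
      intro i j hij
      exact (hd hij).preimage _
    refine measurable_of_tendsto_metrizable
      (fun n => Finset.measurable_sum (Finset.range n) fun i _ => ih i) ?_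
    rw [tendsto_pi_nhds]
    intro ω
    simpa using (this ω).tendsto_sum_nat

theorem meas_pairing {Ω M : Type*} [MeasurableSpace Ω] [MeasurableSpace M] (ℙ : Measure Ω)
    (m : Measure M)
    (H : Ω → M → ℝ) (hH : ∀ ω, Integrable (H ω) m)
    (hHm : ∀ t : Set M, MeasurableSet t → Measurable fun ω => ∫ x in t, H ω x ∂m)
    (Φ : Ω → M → ℝ) (hΦmeas : Measurable (Function.uncurry Φ))
    (G : Ω → ℝ) (hΦG : ∀ᵐ ω ∂ℙ, ∀ᵐ x ∂m, |Φ ω x| ≤ G ω) :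
    AEMeasurable (fun ω => ∫ x, Φ ω x * H ω x ∂m) ℙ := by
  have hmul : ∀ (φ : SimpleFunc (Ω × M) ℝ) ω, Integrable (fun x => φ (ω, x) * H ω x) m := by
    intro φ ω
    obtain ⟨C, hC⟩ := φ.exists_forall_norm_le
    exact (hH ω).bdd_mul (φ.measurable.comp measurable_prodMk_left).aestronglyMeasurable
      (Eventually.of_forall fun x => hC _)
  have hsimp : ∀ φ : SimpleFunc (Ω × M) ℝ, Measurable fun ω => ∫ x, φ (ω, x) * H ω x ∂m := by
    intro φ
    induction φ using SimpleFunc.induction with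
    | const c hs =>
      rename_i s
      have : (fun ω => ∫ x, (SimpleFunc.piecewise s hs (SimpleFunc.const _ c)
          (SimpleFunc.const _ 0) : SimpleFunc (Ω × M) ℝ) (ω, x) * H ω x ∂m)
          = fun ω => c * ∫ x in {x | (ω, x) ∈ s}, H ω x ∂m := by
        ext ω
        have h1 : MeasurableSet {x | (ω, x) ∈ s} := measurable_prodMk_left hs
        rw [← integral_const_mul, ← integral_indicator h1]
        congr 1
        ext x
        by_cases h : (ω, x) ∈ s <;> simp [h, Set.indicator]
      rw [this]
      exact (meas_pairing_set m H hH hHm s hs).const_mul c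
    | add hd hf hg =>
      rename_i f g
      have : (fun ω => ∫ x, (f + g) (ω, x) * H ω x ∂m)
          = fun ω => ∫ x, f (ω, x) * H ω x ∂m + ∫ x, g (ω, x) * H ω x ∂m := by
        ext ω
        rw [← integral_add (hmul f ω) (hmul g ω)]
        simp [add_mul]
      rw [this]
      exact hf.add hg
  let φ : ℕ → SimpleFunc (Ω × M) ℝ := fun n =>
    SimpleFunc.approxOn (Function.uncurry Φ) hΦmeas Set.univ 0 (Set.mem_univ _) n
  refine aemeasurable_of_tendsto_metrizable_ae' (f := fun n ω => ∫ x, φ n (ω, x) * H ω x ∂m)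
    (fun n => (hsimp (φ n)).aemeasurable) ?_
  filter_upwards [hΦG] with ω hω
  refine tendsto_integral_of_dominated_convergence (fun x => (G ω + G ω) * |H ω x|)
    (fun n => (hmul (φ n) ω).1) ((hH ω).abs.const_mul _) ?_ ?_
  · intro n
    filter_upwards [hω] with x hx
    rw [norm_mul, Real.norm_eq_abs (H ω x)]
    refine mul_le_mul_of_nonneg_right ?_ (abs_nonneg _)
    refine (SimpleFunc.norm_approxOn_zero_le hΦmeas (Set.mem_univ _) (ω, x) n).trans ?_
    exact add_le_add hx hx
  · refine Eventually.of_forall fun x => ?_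
    refine Tendsto.mul_const _ ?_
    exact SimpleFunc.tendsto_approxOn hΦmeas (Set.mem_univ _) (by simp)

theorem diff_of_cauchy (F : ℝ → ℝ) (I : Set ℝ)
    (hF : ∀ δ > 0, ∃ r > 0, ∀ ε ∈ I, ∀ ε' ∈ I, ε ≠ 0 → ε' ≠ 0 → |ε| < r → |ε'| < r →
      |slope F 0 ε - slope F 0 ε'| < δ) :
    DifferentiableWithinAt ℝ F I 0 := by
  rcases eq_or_neBot (𝓝[I \ {0}] (0 : ℝ)) with hb | hb
  · refine HasDerivWithinAt.differentiableWithinAt (f' := 0) ?_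
    rw [hasDerivWithinAt_iff_tendsto_slope, hb]
    exact tendsto_bot
  · have hc : Cauchy (map (slope F 0) (𝓝[I \ {0}] (0 : ℝ))) := by
      rw [Metric.cauchy_iff]
      refine ⟨inferInstance, fun δ hδ => ?_⟩
      obtain ⟨r, hr, h⟩ := hF δ hδ
      refine ⟨slope F 0 '' ((I \ {0}) ∩ Metric.ball 0 r),
        image_mem_map (inter_mem self_mem_nhdsWithin
          (mem_nhdsWithin_of_mem_nhds (Metric.ball_mem_nhds _ hr))), ?_⟩
      rintro _ ⟨ε, ⟨⟨h1, h2⟩, h3⟩, rfl⟩ _ ⟨ε', ⟨⟨h1', h2'⟩, h3'⟩, rfl⟩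
      rw [Real.dist_eq]
      exact h ε h1 ε' h1' h2 h2' (by simpa using h3) (by simpa using h3')
    obtain ⟨l, hl⟩ := CompleteSpace.complete hc
    refine HasDerivWithinAt.differentiableWithinAt (f' := l) ?_
    rw [hasDerivWithinAt_iff_tendsto_slope]
    exact hl

theorem tele1 {Ω E : Type*} [NormedAddCommGroup E] [NormedSpace ℝ E] (σ : Ω → Ω)
    (L L0 : Ω → E →L[ℝ] E) (w : ℕ → Ω) (hw : ∀ n, σ (w (n + 1)) = w n) (u v : Ω → E)
    (hu : ∀ n, L (w (n + 1)) (u (w (n + 1))) = u (w n))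
    (hv : ∀ n, L0 (w (n + 1)) (v (w (n + 1))) = v (w n)) (n : ℕ) :
    u (w 0) - v (w 0) = iterOp σ L n (w n) (u (w n) - v (w n)) +
      ∑ j ∈ Finset.range n, iterOp σ L j (w j)
        (L (w (j + 1)) (v (w (j + 1))) - L0 (w (j + 1)) (v (w (j + 1)))) := by
  induction n with
  | zero => simp [iterOp]
  | succ n ih =>
    rw [ih, Finset.sum_range_succ]
    have : iterOp σ L (n + 1) (w (n + 1)) (u (w (n + 1)) - v (w (n + 1)))
        = iterOp σ L n (w n) (L (w (n + 1)) (u (w (n + 1)) - v (w (n + 1)))) := by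
      simp only [iterOp, hw, ContinuousLinearMap.comp_apply]
    rw [this, ← hu n, ← hv n]
    simp only [map_sub]
    abel

theorem tele2 {Ω E : Type*} [NormedAddCommGroup E] [NormedSpace ℝ E] (σ : Ω → Ω)
    (L L0 : Ω → E →L[ℝ] E) (w : ℕ → Ω) (hw : ∀ n, σ (w (n + 1)) = w n) (j : ℕ) (y : E) :
    iterOp σ L j (w j) y - iterOp σ L0 j (w j) y =
      ∑ k ∈ Finset.range j, iterOp σ L (j - 1 - k) (w (j - 1 - k))
        (L (w (j - k)) (iterOp σ L0 k (w j) y) - L0 (w (j - k)) (iterOp σ L0 k (w j) y)) := by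
  induction j generalizing y with
  | zero => simp [iterOp]
  | succ j ih =>
    have h1 : ∀ (K : Ω → E →L[ℝ] E) (i : ℕ) (z : E), iterOp σ K (i + 1) (w (j + 1)) z
        = iterOp σ K i (w j) (K (w (j + 1)) z) := by
      intro K i z
      simp only [iterOp, hw, ContinuousLinearMap.comp_apply]
    rw [Finset.sum_range_succ', h1, h1]
    have h2 := ih (L0 (w (j + 1)) y)
    have h4 : ∀ k, j + 1 - (k + 1) = j - k := fun k => by omega
    have h3 : ∀ k, j + 1 - 1 - (k + 1) = j - 1 - k := fun k => by omega
    simp_rw [h3, h4, h1]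
    rw [← h2]
    simp [iterOp]

theorem iterOp_comp {Ω E F : Type*} [NormedAddCommGroup E] [NormedSpace ℝ E]
    [NormedAddCommGroup F] [NormedSpace ℝ F] (σ : Ω → Ω) (ι : F →L[ℝ] E)
    (L : Ω → E →L[ℝ] E) (S : Ω → F →L[ℝ] F) (hc : ∀ ω x, ι (S ω x) = L ω (ι x))
    (n : ℕ) (ω : Ω) (x : F) : ι (iterOp σ S n ω x) = iterOp σ L n ω (ι x) := by
  induction n generalizing ω x with
  | zero => simp [iterOp]
  | succ n ih => simp only [iterOp, ContinuousLinearMap.comp_apply, ih, hc]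

theorem pointwise_bound {Ω Bw Bs Bss : Type*}
    [NormedAddCommGroup Bw] [NormedSpace ℝ Bw]
    [NormedAddCommGroup Bs] [NormedSpace ℝ Bs]
    [NormedAddCommGroup Bss] [NormedSpace ℝ Bss]
    (σ : Ω → Ω) (ιs : Bs →L[ℝ] Bw) (ιss : Bss →L[ℝ] Bs)
    (hιss : ∀ x : Bss, ‖ιss x‖ ≤ ‖x‖)
    (ψ : Bw →L[ℝ] ℝ)
    (L L0 : Ω → Bw →L[ℝ] Bw) (S S0 : Ω → Bs →L[ℝ] Bs) (T T0 : Ω → Bss →L[ℝ] Bss)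
    (hS : ∀ ω x, ιs (S ω x) = L ω (ιs x)) (hS0 : ∀ ω x, ιs (S0 ω x) = L0 ω (ιs x))
    (hT : ∀ ω x, ιss (T ω x) = S ω (ιss x)) (hT0 : ∀ ω x, ιss (T0 ω x) = S0 ω (ιss x))
    (hψL : ∀ ω x, ψ (L ω x) = ψ x) (hψL0 : ∀ ω x, ψ (L0 ω x) = ψ x)
    (Lhat : Ω → Bss →L[ℝ] Bs) (u v : Ω → Bss)
    (w : ℕ → Ω) (hw : ∀ n, σ (w (n + 1)) = w n)
    (ε : ℝ) (hε : ε ≠ 0) (hε1 : |ε| ≤ 1) (β d0 : ℝ) (d1 c2 c3 c4 a b : ℕ → ℝ)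
    (hd1 : ∀ n, 0 ≤ d1 n) (hc2 : ∀ n, 0 ≤ c2 n) (hc3 : ∀ n, 0 ≤ c3 n)
    (ha : ∀ n, 0 ≤ a n) (hb : ∀ n, 0 ≤ b n)
    (H1 : ∀ n, ‖iterOp σ L n (w n)‖ ≤ d0)
    (H2 : ∀ n, 1 ≤ n → ∀ x : Bs, ψ (ιs x) = 0 →
      ‖iterOp σ L n (w n) (ιs x)‖ ≤ d1 n * (n : ℝ) ^ (-β) * ‖x‖)
    (H2' : ∀ n, ∀ x : Bs, ψ (ιs x) = 0 → ‖iterOp σ L n (w n) (ιs x)‖ ≤ d1 n * ‖x‖)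
    (H3 : ∀ n, ∀ x : Bs, ‖L (w n) (ιs x) - L0 (w n) (ιs x)‖ ≤ c2 n * |ε| * ‖x‖)
    (H4a : ∀ n x, ψ (ιs (Lhat (w n) x)) = 0)
    (H4b : ∀ n, ∀ x : Bss,
      ‖(1 / ε) • (S (w n) (ιss x) - S0 (w n) (ιss x)) - Lhat (w n) x‖ ≤ c3 n * |ε| * ‖x‖)
    (H4c : ∀ n, ∀ x : Bss, ‖Lhat (w n) x‖ ≤ c3 n * ‖x‖)
    (H5u : ∀ n, T (w (n + 1)) (u (w (n + 1))) = u (w n))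
    (H5v : ∀ n, T0 (w (n + 1)) (v (w (n + 1))) = v (w n))
    (H5u' : ∀ n, ψ (ιs (ιss (u (w n)))) = 1) (H5v' : ∀ n, ψ (ιs (ιss (v (w n)))) = 1)
    (Hu : ∀ n, ‖u (w n)‖ ≤ c4 n) (Hv : ∀ n, ‖v (w n)‖ ≤ c4 n)
    (H6 : ∀ j k, k < j → ‖iterOp σ S0 k (w j)‖ ≤ a j * b (j - k))
    (N n : ℕ) (hN : 1 ≤ N) (hNn : N ≤ n) :
    ‖(1 / ε) • (ιs (ιss (u (w 0))) - ιs (ιss (v (w 0)))) -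
      ∑ j ∈ Finset.range N, iterOp σ L0 j (w j) (ιs (Lhat (w (j + 1)) (v (w (j + 1)))))‖ ≤
    2 / |ε| * (n : ℝ) ^ (-β) * (d1 n * c4 n)
    + ∑ j ∈ Finset.Ico N n, 2 * (j : ℝ) ^ (-β) * (d1 j * c3 (j + 1) * c4 (j + 1))
    + ∑ j ∈ Finset.range N, (|ε| * (d1 j * c3 (j + 1) * c4 (j + 1))
      + ∑ k ∈ Finset.range j,
        |ε| * (d0 * c2 (j - k) * a j * b (j - k) * c3 (j + 1) * c4 (j + 1))) := by
  have hd0 : 0 ≤ d0 := (norm_nonneg _).trans (H1 0)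
  have hc4 : ∀ n, 0 ≤ c4 n := fun n => (norm_nonneg _).trans (Hu n)
  have hεp : 0 < |ε| := abs_pos.2 hε
  set R : ℕ → Bs := fun j => (1 / ε) • (S (w (j + 1)) (ιss (v (w (j + 1)))) -
    S0 (w (j + 1)) (ιss (v (w (j + 1))))) with hR
  set Λ : ℕ → Bs := fun j => Lhat (w (j + 1)) (v (w (j + 1))) with hΛ
  have hRψ : ∀ j, ψ (ιs (R j)) = 0 := by
    intro j
    simp [hR, hS, hS0, hψL, hψL0]
  have hRΛψ : ∀ j, ψ (ιs (R j - Λ j)) = 0 := by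
    intro j
    rw [map_sub, map_sub, hRψ, H4a, sub_zero]
  have hΛn : ∀ j, ‖Λ j‖ ≤ c3 (j + 1) * c4 (j + 1) := fun j =>
    (H4c _ _).trans (mul_le_mul_of_nonneg_left (Hv _) (hc3 _))
  have hRΛn : ∀ j, ‖R j - Λ j‖ ≤ |ε| * (c3 (j + 1) * c4 (j + 1)) := fun j => by
    refine (H4b (j + 1) (v (w (j + 1)))).trans ?_
    have := mul_le_mul_of_nonneg_left (Hv (j + 1)) (mul_nonneg (hc3 (j + 1)) hεp.le)
    linarith
  have hRn : ∀ j, ‖R j‖ ≤ 2 * (c3 (j + 1) * c4 (j + 1)) := fun j => by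
    have h1 : ‖R j‖ ≤ ‖R j - Λ j‖ + ‖Λ j‖ := by
      simpa using norm_add_le (R j - Λ j) (Λ j)
    have h2 := hRΛn j
    have h3 := hΛn j
    have h4 : |ε| * (c3 (j + 1) * c4 (j + 1)) ≤ 1 * (c3 (j + 1) * c4 (j + 1)) :=
      mul_le_mul_of_nonneg_right hε1 (mul_nonneg (hc3 _) (hc4 _))
    linarith
  have ht := tele1 σ L L0 w hw (fun ω => ιs (ιss (u ω))) (fun ω => ιs (ιss (v ω)))
    (fun n => by rw [← H5u n, hT, hS]) (fun n => by rw [← H5v n, hT0, hS0]) n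
  have hdec : (1 / ε) • (ιs (ιss (u (w 0))) - ιs (ιss (v (w 0)))) -
      ∑ j ∈ Finset.range N, iterOp σ L0 j (w j) (ιs (Λ j))
      = (1 / ε) • iterOp σ L n (w n) (ιs (ιss (u (w n)) - ιss (v (w n))))
      + ∑ j ∈ Finset.Ico N n, iterOp σ L j (w j) (ιs (R j))
      + ∑ j ∈ Finset.range N, (iterOp σ L j (w j) (ιs (R j - Λ j))
        + (iterOp σ L j (w j) (ιs (Λ j)) - iterOp σ L0 j (w j) (ιs (Λ j)))) := by
    have h1 : (1 / ε) • ∑ j ∈ Finset.range n, iterOp σ L j (w j)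
        (L (w (j + 1)) (ιs (ιss (v (w (j + 1))))) - L0 (w (j + 1)) (ιs (ιss (v (w (j + 1))))))
        = ∑ j ∈ Finset.range n, iterOp σ L j (w j) (ιs (R j)) := by
      rw [Finset.smul_sum]
      refine Finset.sum_congr rfl fun j _ => ?_
      rw [← map_smul]
      simp only [hR, map_smul, map_sub, hS, hS0]
    rw [ht, smul_add, h1, ← Finset.sum_range_add_sum_Ico _ hNn, add_sub_assoc, add_assoc,
      map_sub ιs]
    congr 1
    rw [add_comm (∑ j ∈ Finset.range N, _), add_sub_assoc, ← Finset.sum_sub_distrib]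
    congr 1
    refine Finset.sum_congr rfl fun j _ => ?_
    simp only [map_sub]
    abel
  rw [hdec]
  refine (norm_add_le _ _).trans (add_le_add ((norm_add_le _ _).trans (add_le_add ?_ ?_)) ?_)
  · rw [norm_smul, norm_div, norm_one, Real.norm_eq_abs]
    have h1 := H2 n (hN.trans hNn) (ιss (u (w n)) - ιss (v (w n)))
      (by rw [map_sub, map_sub, H5u', H5v', sub_self])
    have h2 : ‖ιss (u (w n)) - ιss (v (w n))‖ ≤ 2 * c4 n := by
      refine (norm_sub_le _ _).trans ?_
      linarith [(hιss _).trans (Hu n), (hιss _).trans (Hv n)]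
    have h3 : 0 ≤ d1 n * (n : ℝ) ^ (-β) := mul_nonneg (hd1 n) (by positivity)
    calc _ ≤ 1 / |ε| * (d1 n * (n : ℝ) ^ (-β) * (2 * c4 n)) :=
          mul_le_mul_of_nonneg_left (h1.trans (mul_le_mul_of_nonneg_left h2 h3)) (by positivity)
      _ = _ := by ring
  · refine (norm_sum_le _ _).trans (Finset.sum_le_sum fun j hj => ?_)
    have hj1 : 1 ≤ j := hN.trans (Finset.mem_Ico.1 hj).1
    have h3 : 0 ≤ d1 j * (j : ℝ) ^ (-β) := mul_nonneg (hd1 j) (by positivity)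
    refine (H2 j hj1 _ (hRψ j)).trans ((mul_le_mul_of_nonneg_left (hRn j) h3).trans ?_)
    apply le_of_eq
    ring
  · refine (norm_sum_le _ _).trans (Finset.sum_le_sum fun j _ => ?_)
    refine (norm_add_le _ _).trans (add_le_add ?_ ?_)
    · refine (H2' j _ (hRΛψ j)).trans
        ((mul_le_mul_of_nonneg_left (hRΛn j) (hd1 j)).trans (le_of_eq ?_))
      ring
    · rw [tele2 σ L L0 w hw j]
      refine (norm_sum_le _ _).trans (Finset.sum_le_sum fun k hk => ?_)
      have hk' := Finset.mem_range.1 hk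
      rw [← iterOp_comp σ ιs L0 S0 hS0]
      have e1 : ‖iterOp σ S0 k (w j) (Λ j)‖ ≤ a j * b (j - k) * (c3 (j + 1) * c4 (j + 1)) :=
        (ContinuousLinearMap.le_opNorm _ _).trans
          (mul_le_mul (H6 j k hk') (hΛn j) (norm_nonneg _) (mul_nonneg (ha _) (hb _)))
      have e2 := (H3 (j - k) (iterOp σ S0 k (w j) (Λ j))).trans
        (mul_le_mul_of_nonneg_left e1 (mul_nonneg (hc2 _) hεp.le))
      refine (ContinuousLinearMap.le_opNorm _ _).trans
        ((mul_le_mul (H1 _) e2 (norm_nonneg _) hd0).trans (le_of_eq ?_))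
      ring

end helpers

theorem stmt_3
    {Ω : Type*} [MeasurableSpace Ω] (ℙ : Measure Ω) [IsProbabilityMeasure ℙ]
    (σ σinv : Ω → Ω)
    (hσ : MeasurePreserving σ ℙ ℙ) (hσinv : Measurable σinv)
    (hinv₁ : Function.LeftInverse σinv σ) (hinv₂ : Function.RightInverse σinv σ)
    (hErg : Ergodic σ ℙ)
    -- the underlying probability space (M, 𝓜, m)
    {M : Type*} [MeasurableSpace M] (m : Measure M) [IsProbabilityMeasure m]
    {Bw Bs Bss : Type*}
    [NormedAddCommGroup Bw] [NormedSpace ℝ Bw] [CompleteSpace Bw]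
    [NormedAddCommGroup Bs] [NormedSpace ℝ Bs]
    [NormedAddCommGroup Bss] [NormedSpace ℝ Bss]
    [MeasurableSpace Bss] [BorelSpace Bss]
    (ιs : Bs →L[ℝ] Bw) (ιss : Bss →L[ℝ] Bs)
    (hιs : ∀ x : Bs, ‖ιs x‖ ≤ ‖x‖) (hιss : ∀ x : Bss, ‖ιss x‖ ≤ ‖x‖)
    -- realization of elements of 𝓑_w as measurable functions on M, with
    -- 𝓑_w ⊆ L¹(m) and ‖·‖_{L¹(m)} ≤ ‖·‖_w, and ψ(f) = ∫ f dm
    (emb : Bw →ₗ[ℝ] (M → ℝ))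
    (hembInt : ∀ f : Bw, Integrable (emb f) m)
    (hembL1 : ∀ f : Bw, ∫ x, |emb f x| ∂m ≤ ‖f‖)
    (ψ : Bw →L[ℝ] ℝ) (hψ : ∀ f : Bw, ψ f = ∫ x, emb f x ∂m)
    (I : Set ℝ) (hIopen : IsOpen I) (hIsub : I ⊆ Set.Ioo (-1) 1) (hI0 : (0 : ℝ) ∈ I)
    (Lw : ℝ → Ω → Bw →L[ℝ] Bw) (Ls : ℝ → Ω → Bs →L[ℝ] Bs) (Lss : ℝ → Ω → Bss →L[ℝ] Bss)
    (hcomp_s : ∀ ε ω x, ιs (Ls ε ω x) = Lw ε ω (ιs x))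
    (hcomp_ss : ∀ ε ω x, ιss (Lss ε ω x) = Ls ε ω (ιss x))
    (hψinv : ∀ ε ∈ I, ∀ ω : Ω, ∀ x : Bw, ψ (Lw ε ω x) = ψ x)
    (p0 p1 p2 p3 p4 p5 : ℝ)
    (hp0 : 0 < p0) (hp1 : 0 < p1) (hp2 : 0 < p2) (hp3 : 0 < p3) (hp4 : 0 < p4) (hp5 : 0 < p5)
    (C0 C1 C2 C3 C4 A B : Ω → ℝ)
    (hC0 : MemLpRV ℙ p0 C0) (hC1 : MemLpRV ℙ p1 C1) (hC2 : MemLpRV ℙ p2 C2)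
    (hC3 : MemLpRV ℙ p3 C3) (hC4 : MemLpRV ℙ p4 C4)
    (hA : MemLpRV ℙ p5 A) (hB : MemLpRV ℙ p5 B)
    (β : ℝ) (hβ : 1 < β)
    -- for each ε ∈ I, a full-measure set Ω_ε
    (Ωe : ℝ → Set Ω) (hΩe : ∀ ε ∈ I, ℙ (Ωe ε)ᶜ = 0)
    (Lhat : Ω → Bss →L[ℝ] Bs)
    (h : ℝ → Ω → Bss)
    (hmeas : ∀ ε ∈ I, Measurable (h ε))
    -- (C1)
    (cond1 : ∀ n : ℕ, 1 ≤ n → ∀ ε ∈ I, ∀ ω ∈ Ωe ε,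
      ‖iterOp σ (Lw ε) n (σinv^[n] ω)‖ ≤ C0 ω)
    -- (C2)
    (cond2 : ∀ n : ℕ, 1 ≤ n → ∀ ε ∈ I, ∀ ω ∈ Ωe ε, ∀ x : Bs, ψ (ιs x) = 0 →
      ‖iterOp σ (Lw ε) n ω (ιs x)‖ ≤ C1 ω * (n : ℝ) ^ (-β) * ‖x‖)
    -- (C3)
    (cond3 : ∀ ε ∈ I, ∀ ω ∈ Ωe ε, ∀ x : Bs,
      ‖Lw ε ω (ιs x) - Lw 0 ω (ιs x)‖ ≤ C2 ω * |ε| * ‖x‖)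
    -- (C4)
    (cond4a : ∀ᵐ ω ∂ℙ, ∀ x : Bss, ψ (ιs (Lhat ω x)) = 0)
    (cond4b : ∀ ε ∈ I, ε ≠ 0 → ∀ ω ∈ Ωe ε, ∀ x : Bss,
      ‖(1 / ε) • (Ls ε ω (ιss x) - Ls 0 ω (ιss x)) - Lhat ω x‖ ≤ C3 ω * |ε| * ‖x‖)
    (cond4c : ∀ᵐ ω ∂ℙ, ∀ x : Bss, ‖Lhat ω x‖ ≤ C3 ω * ‖x‖)
    -- (C5), with h_{ω,ε} ≥ 0
    (cond5a : ∀ ε ∈ I, ∀ ω ∈ Ωe ε, Lss ε ω (h ε ω) = h ε (σ ω))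
    (cond5b : ∀ ε ∈ I, ∀ ω ∈ Ωe ε, ψ (ιs (ιss (h ε ω))) = 1)
    (cond5c : ∀ ε ∈ I, ∀ ω ∈ Ωe ε, ‖h ε ω‖ ≤ C4 ω)
    (cond5d : ∀ ε ∈ I, ∀ ω ∈ Ωe ε, ∀ᵐ x ∂m, 0 ≤ emb (ιs (ιss (h ε ω))) x)
    -- (C6)
    (cond6 : ∀ᵐ ω ∂ℙ, ∀ n : ℕ, 1 ≤ n → ∀ j ≤ n,
      ‖iterOp σ (Ls 0) j (σinv^[n] ω)‖ ≤ A (σinv^[n] ω) * B (σinv^[n - j] ω))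
    -- the observable Φ
    (Φ : Ω → M → ℝ) (hΦmeas : Measurable (Function.uncurry Φ))
    (G : Ω → ℝ) (p6 : ℝ) (hp6 : 0 < p6)
    (hG : MemLpRV ℙ p6 G)
    (hΦG : ∀ᵐ ω ∂ℙ, ∀ᵐ x ∂m, |Φ ω x| ≤ G ω)
    (hcoeff1 : 1 / p6 + 1 / p1 + 1 / p3 + 1 / p4 ≤ 1)
    (hcoeff2 : 1 / p6 + 1 / p0 + 1 / p2 + 2 / p5 + 1 / p3 + 1 / p4 ≤ 1) :
    DifferentiableWithinAt ℝ
      (fun ε : ℝ => ∫ ω, (∫ x, Φ ω x * emb (ιs (ιss (h ε ω))) x ∂m) ∂ℙ) I 0 := by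
  classical
  have hτ1 : MeasurePreserving σinv ℙ ℙ := by
    refine ⟨hσinv, ?_⟩
    conv_lhs => rw [← hσ.map_eq]
    rw [Measure.map_map hσinv hσ.measurable, hinv₁.comp_eq_id, Measure.map_id]
  have hτ : ∀ n, MeasurePreserving (σinv^[n]) ℙ ℙ := fun n => hτ1.iterate n
  have hw : ∀ ω n, σ (σinv^[n + 1] ω) = σinv^[n] ω := fun ω n => by
    rw [Function.iterate_succ_apply', hinv₂]
  have hid : MeasurePreserving (fun ω : Ω => ω) ℙ ℙ := MeasurePreserving.id ℙ
  have horb : ∀ P : Ω → Prop, (∀ᵐ ω ∂ℙ, P ω) → ∀ᵐ ω ∂ℙ, ∀ n, P (σinv^[n] ω) := fun P hP =>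
    ae_all_iff.2 fun n => (hτ n).quasiMeasurePreserving.ae hP
  have hΩae : ∀ ε ∈ I, ∀ᵐ ω ∂ℙ, ω ∈ Ωe ε := fun ε hε => mem_ae_iff.2 (hΩe ε hε)
  have hD0 := hC0.add_one hp0
  have hD1 := hC1.add_one hp1
  have hi0 := one_div_pos.2 hp0
  have hi1 := one_div_pos.2 hp1
  have hi2 := one_div_pos.2 hp2
  have hi3 := one_div_pos.2 hp3
  have hi4 := one_div_pos.2 hp4
  have hi5 := one_div_pos.2 hp5
  have hi6 := one_div_pos.2 hp6
  have h25 : 2 / p5 = 1 / p5 + 1 / p5 := by ring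
  obtain ⟨Ka, hKa0, hKa⟩ := holder_bound ℙ ![G, fun ω => C1 ω + 1, C4] ![p6, p1, p4]
    (by simp [Fin.forall_fin_succ, *])
    (by simp only [Fin.sum_univ_succ]; simp [-one_div]; linarith)
    (by simp only [Fin.forall_fin_succ]; simp; exact ⟨hG, hD1, hC4⟩)
  obtain ⟨Kb, hKb0, hKb⟩ := holder_bound ℙ ![G, fun ω => C1 ω + 1, C3, C4] ![p6, p1, p3, p4]
    (by simp [Fin.forall_fin_succ, *])
    (by simp only [Fin.sum_univ_succ]; simp [-one_div]; linarith)
    (by simp only [Fin.forall_fin_succ]; simp; exact ⟨hG, hD1, hC3, hC4⟩)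
  obtain ⟨Kc, hKc0, hKc⟩ := holder_bound ℙ ![G, fun ω => C0 ω + 1, C2, A, B, C3, C4]
    ![p6, p0, p2, p5, p5, p3, p4]
    (by simp [Fin.forall_fin_succ, *])
    (by rw [h25] at hcoeff2; simp only [Fin.sum_univ_succ]; simp [-one_div]; linarith)
    (by simp only [Fin.forall_fin_succ]; simp; exact ⟨hG, hD0, hC2, hA, hB, hC3, hC4⟩)
  obtain ⟨Kd, hKd0, hKd⟩ := holder_bound ℙ ![G, C4] ![p6, p4]
    (by simp [Fin.forall_fin_succ, *])
    (by simp only [Fin.sum_univ_succ]; simp [-one_div]; linarith)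
    (by simp only [Fin.forall_fin_succ]; simp; exact ⟨hG, hC4⟩)
  have bA : ∀ n, IntLe ℙ (fun ω => G ω * ((C1 (σinv^[n] ω) + 1) * C4 (σinv^[n] ω))) Ka := by
    intro n
    have := hKa ![fun ω => ω, σinv^[n], σinv^[n]]
      (by simp only [Fin.forall_fin_succ]; simp; exact ⟨hid, hτ n⟩)
    simpa [Fin.prod_univ_succ] using this
  have bB : ∀ j, IntLe ℙ (fun ω => G ω * ((C1 (σinv^[j] ω) + 1) * C3 (σinv^[j + 1] ω)
      * C4 (σinv^[j + 1] ω))) Kb := by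
    intro j
    have := hKb ![fun ω => ω, σinv^[j], σinv^[j + 1], σinv^[j + 1]]
      (by simp only [Fin.forall_fin_succ]; simp [-Function.iterate_succ]; exact ⟨hid, hτ j, hτ (j + 1)⟩)
    simpa [Fin.prod_univ_succ, -Function.iterate_succ, mul_assoc] using this
  have bC : ∀ j k, IntLe ℙ (fun ω => G ω * ((C0 ω + 1) * C2 (σinv^[j - k] ω)
      * A (σinv^[j] ω) * B (σinv^[j - k] ω) * C3 (σinv^[j + 1] ω)
      * C4 (σinv^[j + 1] ω))) Kc := by
    intro j k
    have := hKc ![fun ω => ω, fun ω => ω, σinv^[j - k], σinv^[j], σinv^[j - k],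
      σinv^[j + 1], σinv^[j + 1]]
      (by
        simp only [Fin.forall_fin_succ]; simp [-Function.iterate_succ]
        exact ⟨hid, hτ (j - k), hτ j, hτ (j - k), hτ (j + 1)⟩)
    simpa [Fin.prod_univ_succ, -Function.iterate_succ, mul_assoc] using this
  have bD : IntLe ℙ (fun ω => G ω * C4 ω) Kd := by
    have := hKd ![fun ω => ω, fun ω => ω]
      (by simp only [Fin.forall_fin_succ]; simp; exact hid)
    simpa [Fin.prod_univ_succ] using this
  -- the pairing with the observable
  have hP : ∀ᵐ ω ∂ℙ, ∃ P : Bw →ₗ[ℝ] ℝ, (∀ f, P f = ∫ x, Φ ω x * emb f x ∂m) ∧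
      ∀ f, |P f| ≤ G ω * ‖f‖ := by
    filter_upwards [hΦG] with ω hω
    have hinteg : ∀ f, Integrable (fun x => Φ ω x * emb f x) m := fun f =>
      (hembInt f).bdd_mul (c := G ω) (hΦmeas.comp measurable_prodMk_left).aestronglyMeasurable hω
    refine ⟨⟨⟨fun f => ∫ x, Φ ω x * emb f x ∂m, ?_⟩, ?_⟩, fun f => rfl, ?_⟩
    · intro f g
      rw [← integral_add (hinteg f) (hinteg g)]
      simp [mul_add]
    · intro c f
      simp only [map_smul, Pi.smul_apply, smul_eq_mul, RingHom.id_apply]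
      rw [← integral_const_mul]
      congr 1
      ext x
      ring
    · intro f
      have h1 : ‖∫ x, Φ ω x * emb f x ∂m‖ ≤ ∫ x, G ω * |emb f x| ∂m := by
        refine norm_integral_le_of_norm_le ((hembInt f).abs.const_mul _) ?_
        filter_upwards [hω] with x hx
        rw [norm_mul]
        exact mul_le_mul_of_nonneg_right hx (abs_nonneg _)
      rw [integral_const_mul] at h1
      exact h1.trans (mul_le_mul_of_nonneg_left (hembL1 f) (hG.2.1 ω))
  -- measurability and integrability of the fibre integrals
  have hfint : ∀ ε ∈ I, Integrable
      (fun ω => ∫ x, Φ ω x * emb (ιs (ιss (h ε ω))) x ∂m) ℙ := by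
    intro ε hε
    refine bD.1.mono' (AEMeasurable.aestronglyMeasurable ?_) ?_
    · refine meas_pairing ℙ m (fun ω => emb (ιs (ιss (h ε ω)))) (fun ω => hembInt _) ?_
        Φ hΦmeas G hΦG
      intro t ht
      let ℓ : Bw →ₗ[ℝ] ℝ :=
        { toFun := fun f => ∫ x in t, emb f x ∂m
          map_add' := fun f g => by
            rw [← integral_add (hembInt f).integrableOn (hembInt g).integrableOn]
            simp
          map_smul' := fun c f => by
            simp only [map_smul, Pi.smul_apply, smul_eq_mul, RingHom.id_apply]
            rw [← integral_const_mul] }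
      have hℓ : ∀ f, ‖ℓ f‖ ≤ 1 * ‖f‖ := fun f => by
        rw [one_mul]
        refine (norm_integral_le_integral_norm _).trans (le_trans ?_ (hembL1 f))
        exact setIntegral_le_integral (hembInt f).norm
          (Filter.Eventually.of_forall fun x => norm_nonneg _)
      have hcont : Continuous fun y : Bss => (ℓ.mkContinuous 1 hℓ) (ιs (ιss y)) := by fun_prop
      exact hcont.measurable.comp (hmeas ε hε)
    · filter_upwards [hP, hΩae ε hε] with ω ⟨P, hP1, hP2⟩ hω
      rw [← hP1, Real.norm_eq_abs]
      refine (hP2 _).trans (mul_le_mul_of_nonneg_left ?_ (hG.2.1 ω))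
      exact (hιs _).trans ((hιss _).trans (cond5c ε hε ω hω))
  -- the pointwise estimate
  have hkey : ∀ ε ∈ I, ε ≠ 0 → ∀ᵐ ω ∂ℙ, ∀ N n : ℕ, 1 ≤ N → N ≤ n →
      ‖(1 / ε) • (ιs (ιss (h ε ω)) - ιs (ιss (h 0 ω))) -
        ∑ j ∈ Finset.range N, iterOp σ (Lw 0) j (σinv^[j] ω)
          (ιs (Lhat (σinv^[j + 1] ω) (h 0 (σinv^[j + 1] ω))))‖ ≤
      2 / |ε| * (n : ℝ) ^ (-β) * ((C1 (σinv^[n] ω) + 1) * C4 (σinv^[n] ω))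
      + ∑ j ∈ Finset.Ico N n, 2 * (j : ℝ) ^ (-β) *
        ((C1 (σinv^[j] ω) + 1) * C3 (σinv^[j + 1] ω) * C4 (σinv^[j + 1] ω))
      + ∑ j ∈ Finset.range N, (|ε| *
        ((C1 (σinv^[j] ω) + 1) * C3 (σinv^[j + 1] ω) * C4 (σinv^[j + 1] ω))
        + ∑ k ∈ Finset.range j, |ε| * ((C0 ω + 1) * C2 (σinv^[j - k] ω)
          * A (σinv^[j] ω) * B (σinv^[j - k] ω) * C3 (σinv^[j + 1] ω)
          * C4 (σinv^[j + 1] ω))) := by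
    intro ε hε hε0
    filter_upwards [horb _ (hΩae ε hε), horb _ (hΩae 0 hI0), horb _ cond4a, horb _ cond4c,
      cond6] with ω g1 g2 g3 g4 g5 N n hN hNn
    have hε1 : |ε| ≤ 1 := (abs_lt.2 (hIsub hε)).le
    have hpow : ∀ n : ℕ, 1 ≤ n → (n : ℝ) ^ (-β) ≤ 1 := fun n hn =>
      Real.rpow_le_one_of_one_le_of_nonpos (by exact_mod_cast hn) (by linarith)
    have H2 : ∀ n : ℕ, 1 ≤ n → ∀ x : Bs, ψ (ιs x) = 0 →
        ‖iterOp σ (Lw ε) n (σinv^[n] ω) (ιs x)‖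
          ≤ (C1 (σinv^[n] ω) + 1) * (n : ℝ) ^ (-β) * ‖x‖ := by
      intro n hn x hx
      refine (cond2 n hn ε hε _ (g1 n) x hx).trans ?_
      have : 0 ≤ (n : ℝ) ^ (-β) := by positivity
      gcongr
      linarith
    exact pointwise_bound σ ιs ιss hιss ψ (Lw ε) (Lw 0) (Ls ε) (Ls 0) (Lss ε) (Lss 0)
      (hcomp_s ε) (hcomp_s 0) (hcomp_ss ε) (hcomp_ss 0) (hψinv ε hε) (hψinv 0 hI0) Lhat
      (h ε) (h 0) (fun n => σinv^[n] ω) (hw ω) ε hε0 hε1 β (C0 ω + 1)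
      (fun n => C1 (σinv^[n] ω) + 1) (fun n => C2 (σinv^[n] ω)) (fun n => C3 (σinv^[n] ω))
      (fun n => C4 (σinv^[n] ω)) (fun n => A (σinv^[n] ω)) (fun n => B (σinv^[n] ω))
      (fun n => hD1.2.1 _) (fun n => hC2.2.1 _) (fun n => hC3.2.1 _) (fun n => hA.2.1 _)
      (fun n => hB.2.1 _)
      (by
        intro n
        have h0 := hC0.2.1 ω
        rcases Nat.eq_zero_or_pos n with rfl | hn
        · refine ContinuousLinearMap.norm_id_le.trans ?_
          linarith
        · refine (cond1 n hn ε hε ω (g1 0)).trans ?_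
          linarith)
      H2
      (by
        intro n x hx
        rcases Nat.eq_zero_or_pos n with rfl | hn
        · have h1 := hC1.2.1 (σinv^[0] ω)
          refine (hιs x).trans ?_
          nlinarith [norm_nonneg x]
        · refine (H2 n hn x hx).trans ?_
          have h1 := hD1.2.1 (σinv^[n] ω)
          refine mul_le_mul_of_nonneg_right ?_ (norm_nonneg _)
          exact mul_le_of_le_one_right h1 (hpow n hn))
      (fun n x => cond3 ε hε _ (g1 n) x) g3 (fun n x => cond4b ε hε hε0 _ (g1 n) x) g4
      (fun n => by
        have := cond5a ε hε _ (g1 (n + 1))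
        rwa [hw] at this)
      (fun n => by
        have := cond5a 0 hI0 _ (g2 (n + 1))
        rwa [hw] at this)
      (fun n => cond5b ε hε _ (g1 n)) (fun n => cond5b 0 hI0 _ (g2 n))
      (fun n => cond5c ε hε _ (g1 n)) (fun n => cond5c 0 hI0 _ (g2 n))
      (fun j k hk => g5 j (by omega) k hk.le) N n hN hNn
  -- integrated estimate
  have hinteg : ∀ δ > 0, ∃ N : ℕ, ∃ r > 0, ∀ ε ∈ I, ε ≠ 0 → |ε| < r → ∃ Q : Ω → ℝ,
      IntLe ℙ Q (3 * δ) ∧ ∀ᵐ ω ∂ℙ, G ω * ‖(1 / ε) • (ιs (ιss (h ε ω)) - ιs (ιss (h 0 ω))) -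
        ∑ j ∈ Finset.range N, iterOp σ (Lw 0) j (σinv^[j] ω)
          (ιs (Lhat (σinv^[j + 1] ω) (h 0 (σinv^[j + 1] ω))))‖ ≤ Q ω := by
    intro δ hδ
    have hsum : Summable fun j : ℕ => 2 * (j : ℝ) ^ (-β) * Kb :=
      ((Real.summable_nat_rpow.2 (by linarith)).mul_left 2).mul_right Kb
    obtain ⟨N0, hN0⟩ := Metric.cauchySeq_iff.1 hsum.hasSum.tendsto_sum_nat.cauchySeq δ hδ
    set N := max N0 1 with hNdef
    have hN1 : 1 ≤ N := le_max_right _ _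
    have htail : ∀ n, N ≤ n → ∑ j ∈ Finset.Ico N n, 2 * (j : ℝ) ^ (-β) * Kb ≤ δ := by
      intro n hn
      rw [Finset.sum_Ico_eq_sub _ hn]
      have := hN0 n ((le_max_left _ _).trans hn) N (le_max_left _ _)
      rw [Real.dist_eq] at this
      exact (le_abs_self _).trans this.le
    set W : ℝ := ∑ j ∈ Finset.range N, (Kb + ∑ k ∈ Finset.range j, Kc) with hW
    have hW0 : 0 ≤ W := Finset.sum_nonneg fun j _ =>
      add_nonneg hKb0 (Finset.sum_nonneg fun k _ => hKc0)
    refine ⟨N, δ / (W + 1), by positivity, fun ε hε hε0 hεr => ?_⟩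
    have hεW : |ε| * W ≤ δ := by
      rw [lt_div_iff₀ (by linarith)] at hεr
      nlinarith [abs_nonneg ε]
    have hlim : Filter.Tendsto (fun n : ℕ => 2 / |ε| * (n : ℝ) ^ (-β) * Ka) Filter.atTop
        (nhds 0) := by
      have := ((((tendsto_rpow_neg_atTop (by linarith : 0 < β)).comp
        tendsto_natCast_atTop_atTop).const_mul (2 / |ε|)).mul_const Ka)
      simpa using this
    obtain ⟨n, hn1, hn2⟩ := ((hlim.eventually (gt_mem_nhds hδ)).and
      (Filter.eventually_ge_atTop N)).exists
    have hbound := (((bA n).const_mul (c := 2 / |ε| * (n : ℝ) ^ (-β)) (by positivity)).add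
      (IntLe.sum (s := Finset.Ico N n) fun j _ =>
        (bB j).const_mul (c := 2 * (j : ℝ) ^ (-β)) (by positivity))).add
      (IntLe.sum (s := Finset.range N) fun j _ =>
        ((bB j).const_mul (abs_nonneg ε)).add
          (IntLe.sum (s := Finset.range j) fun k _ => (bC j k).const_mul (abs_nonneg ε)))
    refine ⟨_, ⟨hbound.1, hbound.2.trans ?_⟩, ?_⟩
    · have h1 : ∑ j ∈ Finset.range N, (|ε| * Kb + ∑ k ∈ Finset.range j, |ε| * Kc) = |ε| * W := by
        rw [hW, Finset.mul_sum]
        refine Finset.sum_congr rfl fun j _ => ?_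
        rw [mul_add, Finset.mul_sum]
      rw [h1]
      linarith [htail n hn2]
    · filter_upwards [hkey ε hε hε0] with ω hω
      refine (mul_le_mul_of_nonneg_left (hω N n hN1 hn2) (hG.2.1 ω)).trans (le_of_eq ?_)
      simp only [mul_add, Finset.mul_sum]
      simp only [mul_left_comm (G ω), mul_assoc]
  -- conclusion
  refine diff_of_cauchy _ I fun δ hδ => ?_
  obtain ⟨N, r, hr, hN⟩ := hinteg (δ / 7) (by positivity)
  refine ⟨r, hr, fun ε hε ε' hε' hε0 hε0' hεr hεr' => ?_⟩
  obtain ⟨Q, hQ, hQb⟩ := hN ε hε hε0 hεr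
  obtain ⟨Q', hQ', hQb'⟩ := hN ε' hε' hε0' hεr'
  have hslope : ∀ ε ∈ I, slope (fun ε : ℝ => ∫ ω, (∫ x, Φ ω x * emb (ιs (ιss (h ε ω))) x ∂m) ∂ℙ)
      0 ε = ∫ ω, (1 / ε) * ((∫ x, Φ ω x * emb (ιs (ιss (h ε ω))) x ∂m) -
        ∫ x, Φ ω x * emb (ιs (ιss (h 0 ω))) x ∂m) ∂ℙ := by
    intro ε hε
    rw [slope_def_field, integral_const_mul, integral_sub (hfint ε hε) (hfint 0 hI0)]
    ring
  have hqi : ∀ ε ∈ I, Integrable (fun ω => (1 / ε) *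
      ((∫ x, Φ ω x * emb (ιs (ιss (h ε ω))) x ∂m) -
        ∫ x, Φ ω x * emb (ιs (ιss (h 0 ω))) x ∂m)) ℙ := fun ε hε =>
    ((hfint ε hε).sub (hfint 0 hI0)).const_mul _
  rw [hslope ε hε, hslope ε' hε', ← integral_sub (hqi ε hε) (hqi ε' hε'), ← Real.norm_eq_abs]
  have hsum := hQ.add hQ'
  refine lt_of_le_of_lt ((norm_integral_le_of_norm_le hsum.1 ?_).trans hsum.2) (by linarith)
  filter_upwards [hP, hQb, hQb'] with ω ⟨P, hP1, hP2⟩ k1 k2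
  simp only [← hP1]
  have hlin : (1 / ε) * (P (ιs (ιss (h ε ω))) - P (ιs (ιss (h 0 ω)))) -
      (1 / ε') * (P (ιs (ιss (h ε' ω))) - P (ιs (ιss (h 0 ω)))) =
      P ((1 / ε) • (ιs (ιss (h ε ω)) - ιs (ιss (h 0 ω))) -
        (1 / ε') • (ιs (ιss (h ε' ω)) - ιs (ιss (h 0 ω)))) := by
    simp only [LinearMap.map_sub, LinearMap.map_smul, smul_eq_mul]
  rw [hlin, Real.norm_eq_abs]
  refine (hP2 _).trans (le_trans ?_ (add_le_add k1 k2))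
  rw [← mul_add]
  refine mul_le_mul_of_nonneg_left ?_ (hG.2.1 ω)
  rw [← dist_eq_norm, ← dist_eq_norm, ← dist_eq_norm]
  exact dist_triangle_right _ _ _
end
end

section
/- Let γ : Ω → [1,∞) with γ ∈ L^{q}(Ω,𝓕,ℙ) for some q > 1, and c : Ω → [0,∞) with c ∈ L^{p}(Ω,𝓕,ℙ), p > 1. Assume the decay condition: there exist a₀ > 0 and E_ω ≥ 1 with E ∈ L^{q₀}(Ω,𝓕,ℙ) such that for ℙ-a.e. ω and all n ≥ 1: max( Π_{j=0}^{n−1} γ_{σ^{j}ω}^{−1}, Π_{j=1}^{n−1} γ_{σ^{−j}ω}^{−1} ) ≤ E_ω·n^{−a₀}. Assume a₀ > 1 + 1/p + 1/q, and let s be given by 1/s = 1/p + 1/q. Then for every sufficiently small δ > 0 there exists a random variable C_ω ≥ 1 with C ∈ L^{t}(Ω,𝓕,ℙ), 1/t = 1/q₀ + 1/p + 1/q, such that for ℙ-a.e. ω: for every n ≥ 1 and all C⁴ real functions z₁,…,z_n on intervals whose composition y = z_n ∘ ⋯ ∘ z₁ is defined, if ‖z_j′‖_∞ ≤ γ_{σ^{−j}ω}^{−1}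 and max(‖z_j″‖_∞, ‖z_j‴‖_∞, ‖z_j⁗‖_∞) ≤ c(σ^{−j}ω) for each j, then ‖y″‖_∞ ≤ C_ω·n^{−η} with η = a₀ − 1 − 1/s − δ. Moreover, if a₀ > 2 + 1/s then there is A_ω ≥ 1 with A ∈ L^{u}, 1/u = 1/q₀ + 2/p + 2/q, such that ‖y‴‖_∞ ≤ A_ω·n^{−ζ} with ζ = a₀ − 2 − 1/s − δ; and if 2a₀ > 3 − 2/s then there is R_ω ≥ 1 with R ∈ L^{u₁}, 1/u₁ = 4/q₀ + 3/s, such that ‖y⁗‖_∞ ≤ R_ω·n^{−κ} with κ = 2a₀ − 3 − 3/s − δ. -/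
open MeasureTheory Function

noncomputable section

/-- The `C^r` norm of a (1-periodic) function on `ℝ`:
`max_{0 ≤ i ≤ r} sup_x |f^{(i)}(x)|`. -/
def crNorm (r : ℕ) (f : ℝ → ℝ) : ℝ :=
  ⨆ p : Fin (r + 1) × ℝ, |iteratedDeriv (p.1 : ℕ) f p.2|

/-- The transfer operator (with respect to Lebesgue/Haar measure) of the circle map
induced by the lift `T : ℝ → ℝ`, acting on (1-periodic) functions:
`L g (x) = Σ_{y : T y = x} g(y)/|T'(y)|`, the sum running over the preimages of `x`
in a fundamental domain `[0,1)`. -/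
def transferOp (T : ℝ → ℝ) (g : ℝ → ℝ) (x : ℝ) : ℝ :=
  ∑' y : {y : ℝ // y ∈ Set.Ico (0 : ℝ) 1 ∧ ∃ k : ℤ, T y = x + k}, g (y : ℝ) / |deriv T (y : ℝ)|

/-- Iterates of maps along an orbit of `σ`: `T^n_ω = T_{σ^{n-1}ω} ∘ ⋯ ∘ T_ω`. -/
def mapIter {Ω : Type*} (σ : Ω → Ω) (T : Ω → ℝ → ℝ) : ℕ → Ω → ℝ → ℝ
  | 0, _, x => x
  | n + 1, ω, x => mapIter σ T n (σ ω) (T ω x)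

/-- Iterates of the transfer operators along an orbit of `σ`:
`L^n_ω = L_{σ^{n-1}ω} ∘ ⋯ ∘ L_ω`. -/
def transferIter {Ω : Type*} (σ : Ω → Ω) (T : Ω → ℝ → ℝ) : ℕ → Ω → (ℝ → ℝ) → ℝ → ℝ
  | 0, _, g => g
  | n + 1, ω, g => transferIter σ T n (σ ω) (transferOp (T ω) g)

/-- The composition `z_n ∘ z_{n-1} ∘ ⋯ ∘ z_1` (the empty composition is the identity). -/
def compSeq (z : ℕ → ℝ → ℝ) : ℕ → ℝ → ℝ
  | 0, x => x
  | n + 1, x => z (n + 1) (compSeq z n x)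

/-- Birkhoff sums `S_n φ (x) = Σ_{j<n} φ_{σ^j ω}(T^j_ω x)` along an orbit of `σ`. -/
def birkSum {Ω : Type*} (σ : Ω → Ω) (T : Ω → ℝ → ℝ) (φ : Ω → ℝ → ℝ) (n : ℕ) (ω : Ω)
    (x : ℝ) : ℝ :=
  ∑ j ∈ Finset.range n, φ (σ^[j] ω) (mapIter σ T j ω x)

/-- Integral over the circle (one period). -/
def circInt (g : ℝ → ℝ) : ℝ := ∫ x in Set.Ioc (0 : ℝ) 1, g x

lemma aux_hasDeriv {f : ℝ → ℝ} (hf : ContDiff ℝ 4 f) (k : ℕ) (hk : k < 4) (x : ℝ) :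
    HasDerivAt (iteratedDeriv k f) (iteratedDeriv (k+1) f x) x := by
  have h : Differentiable ℝ (iteratedDeriv k f) :=
    hf.differentiable_iteratedDeriv k (by exact_mod_cast hk)
  rw [iteratedDeriv_succ]
  exact (h x).hasDerivAt

lemma aux_comp {f y : ℝ → ℝ} (hf : ContDiff ℝ 4 f) (hy : ContDiff ℝ 4 y) (x : ℝ) :
    deriv (fun x => f (y x)) x = deriv f (y x) * deriv y x ∧
    iteratedDeriv 2 (fun x => f (y x)) x
      = iteratedDeriv 2 f (y x) * deriv y x ^ 2 + deriv f (y x) * iteratedDeriv 2 y x ∧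
    iteratedDeriv 3 (fun x => f (y x)) x
      = iteratedDeriv 3 f (y x) * deriv y x ^ 3
        + 3 * iteratedDeriv 2 f (y x) * deriv y x * iteratedDeriv 2 y x
        + deriv f (y x) * iteratedDeriv 3 y x ∧
    iteratedDeriv 4 (fun x => f (y x)) x
      = iteratedDeriv 4 f (y x) * deriv y x ^ 4
        + 6 * iteratedDeriv 3 f (y x) * deriv y x ^ 2 * iteratedDeriv 2 y x
        + iteratedDeriv 2 f (y x) * (4 * deriv y x * iteratedDeriv 3 y x
            + 3 * iteratedDeriv 2 y x ^ 2)
        + deriv f (y x) * iteratedDeriv 4 y x := by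
  simp only [← iteratedDeriv_one]
  have F0 := aux_hasDeriv hf 0 (by norm_num)
  have F1 := aux_hasDeriv hf 1 (by norm_num)
  have F2 := aux_hasDeriv hf 2 (by norm_num)
  have F3 := aux_hasDeriv hf 3 (by norm_num)
  have Y0 := aux_hasDeriv hy 0 (by norm_num)
  have Y1 := aux_hasDeriv hy 1 (by norm_num)
  have Y2 := aux_hasDeriv hy 2 (by norm_num)
  have Y3 := aux_hasDeriv hy 3 (by norm_num)
  simp only [iteratedDeriv_zero, zero_add, Nat.reduceAdd] at F0 F1 F2 F3 Y0 Y1 Y2 Y3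
  have C1 : iteratedDeriv 1 (fun x => f (y x))
      = fun x => iteratedDeriv 1 f (y x) * iteratedDeriv 1 y x := by
    rw [iteratedDeriv_one]; funext x
    exact ((F0 (y x)).comp x (Y0 x)).deriv
  have C2 : iteratedDeriv 2 (fun x => f (y x))
      = fun x => iteratedDeriv 2 f (y x) * iteratedDeriv 1 y x ^ 2
        + iteratedDeriv 1 f (y x) * iteratedDeriv 2 y x := by
    rw [iteratedDeriv_succ, C1]; funext x
    have := (((F1 (y x)).comp x (Y0 x)).mul (Y1 x)).deriv
    refine Eq.trans this ?_
    simp only [Function.comp]; ring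
  have C3 : iteratedDeriv 3 (fun x => f (y x))
      = fun x => iteratedDeriv 3 f (y x) * iteratedDeriv 1 y x ^ 3
        + 3 * iteratedDeriv 2 f (y x) * iteratedDeriv 1 y x * iteratedDeriv 2 y x
        + iteratedDeriv 1 f (y x) * iteratedDeriv 3 y x := by
    rw [iteratedDeriv_succ, C2]; funext x
    have := ((((F2 (y x)).comp x (Y0 x)).mul ((Y1 x).pow 2)).add
      (((F1 (y x)).comp x (Y0 x)).mul (Y2 x))).deriv
    refine Eq.trans this ?_
    simp only [Function.comp, Pi.pow_apply]; push_cast; ring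
  have C4 : iteratedDeriv 4 (fun x => f (y x)) x
      = iteratedDeriv 4 f (y x) * iteratedDeriv 1 y x ^ 4
        + 6 * iteratedDeriv 3 f (y x) * iteratedDeriv 1 y x ^ 2 * iteratedDeriv 2 y x
        + iteratedDeriv 2 f (y x) * (4 * iteratedDeriv 1 y x * iteratedDeriv 3 y x
            + 3 * iteratedDeriv 2 y x ^ 2)
        + iteratedDeriv 1 f (y x) * iteratedDeriv 4 y x := by
    rw [iteratedDeriv_succ, C3]
    have := (((((F3 (y x)).comp x (Y0 x)).mul ((Y1 x).pow 3)).add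
      (((((F2 (y x)).comp x (Y0 x)).const_mul 3).mul (Y1 x)).mul (Y2 x))).add
      (((F1 (y x)).comp x (Y0 x)).mul (Y3 x))).deriv
    refine Eq.trans this ?_
    simp only [Function.comp, Pi.pow_apply, Pi.mul_apply]; push_cast; ring
  exact ⟨by rw [C1], by rw [C2], by rw [C3], C4⟩

lemma aux_compSeq_contDiff (z : ℕ → ℝ → ℝ) (n : ℕ)
    (hz : ∀ j, 1 ≤ j → j ≤ n → ContDiff ℝ 4 (z j)) : ContDiff ℝ 4 (compSeq z n) := by
  induction n with
  | zero => exact contDiff_id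
  | succ n ih =>
    exact (hz (n+1) (by omega) le_rfl).comp (ih fun j h1 h2 => hz j h1 (by omega))

/-- Deterministic bounds. -/
lemma aux_bounds (z : ℕ → ℝ → ℝ) (n : ℕ) (b d : ℕ → ℝ) (hb : ∀ j, 1 ≤ b j)
    (hd : ∀ j, 0 ≤ d j)
    (hz : ∀ j, 1 ≤ j → j ≤ n → ContDiff ℝ 4 (z j))
    (hB : ∀ j, 1 ≤ j → j ≤ n → ∀ x : ℝ, |deriv (z j) x| ≤ (b j)⁻¹ ∧
      |iteratedDeriv 2 (z j) x| ≤ d j ∧ |iteratedDeriv 3 (z j) x| ≤ d j ∧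
      |iteratedDeriv 4 (z j) x| ≤ d j) (x : ℝ) (P H : ℝ)
    (hP : P = ∏ j ∈ Finset.range n, (b (j+1))⁻¹)
    (hH : H = 1 + ∑ j ∈ Finset.range n, d (j+1) * b (j+1)) :
    |deriv (compSeq z n) x| ≤ P ∧ |iteratedDeriv 2 (compSeq z n) x| ≤ P * H ∧
    |iteratedDeriv 3 (compSeq z n) x| ≤ 3 * P * H ^ 2 ∧
    |iteratedDeriv 4 (compSeq z n) x| ≤ 8 * P * H ^ 3 := by
  induction n generalizing P H with
  | zero =>
    have h0 : compSeq z 0 = fun x => x := rfl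
    have e1 : deriv (fun x : ℝ => x) = fun _ => 1 := by funext x; simp
    simp only [Finset.range_zero, Finset.prod_empty, Finset.sum_empty] at hP hH
    subst hP; subst hH
    rw [h0]
    simp [iteratedDeriv_succ', e1, iteratedDeriv_const]
  | succ n ih =>
    set P' := ∏ j ∈ Finset.range n, (b (j+1))⁻¹ with hP'
    set H' := 1 + ∑ j ∈ Finset.range n, d (j+1) * b (j+1) with hH'
    have hP'0 : 0 ≤ P' := Finset.prod_nonneg fun j _ =>
      inv_nonneg.2 (zero_le_one.trans (hb _))
    have hP'1 : P' ≤ 1 := Finset.prod_le_one (fun j _ =>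
      inv_nonneg.2 (zero_le_one.trans (hb _))) fun j _ => inv_le_one_of_one_le₀ (hb _)
    have hH'1 : 1 ≤ H' := by
      have : 0 ≤ ∑ j ∈ Finset.range n, d (j+1) * b (j+1) :=
        Finset.sum_nonneg fun j _ => mul_nonneg (hd _) (zero_le_one.trans (hb _))
      linarith
    obtain ⟨i1, i2, i3, i4⟩ := ih (fun j h1 h2 => hz j h1 (by omega))
      (fun j h1 h2 => hB j h1 (by omega)) P' H' rfl rfl
    have hy := aux_compSeq_contDiff z n (fun j h1 h2 => hz j h1 (by omega))
    obtain ⟨c1, c2, c3, c4⟩ := aux_comp (hz (n+1) (by omega) le_rfl) hy x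
    have hcs : compSeq z (n+1) = fun x => z (n+1) (compSeq z n x) := rfl
    obtain ⟨f1, f2, f3, f4⟩ := hB (n+1) (by omega) le_rfl (compSeq z n x)
    rw [Finset.prod_range_succ, ← hP'] at hP
    rw [Finset.sum_range_succ, ← add_assoc, ← hH'] at hH
    have hbp : 0 < b (n+1) := lt_of_lt_of_le one_pos (hb _)
    set β := b (n+1)
    set D := d (n+1)
    have hD : 0 ≤ D := hd _
    set g := D * β with hg
    have hg0 : 0 ≤ g := mul_nonneg hD hbp.le
    have hP0 : 0 ≤ P := by rw [hP]; exact mul_nonneg hP'0 (inv_nonneg.2 hbp.le)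
    have key : D * P' = g * P := by rw [hP, hg]; field_simp
    have hβ : 0 ≤ β⁻¹ := inv_nonneg.2 hbp.le
    have kk : β⁻¹ * P' = P := by rw [hP]; ring
    rw [hcs, c1, c2, c3, c4]
    clear_value P' H' β D g
    generalize deriv (compSeq z n) x = y1 at *
    generalize iteratedDeriv 2 (compSeq z n) x = y2 at *
    generalize iteratedDeriv 3 (compSeq z n) x = y3 at *
    generalize iteratedDeriv 4 (compSeq z n) x = y4 at *
    generalize deriv (z (n+1)) (compSeq z n x) = w1 at *
    generalize iteratedDeriv 2 (z (n+1)) (compSeq z n x) = w2 at *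
    generalize iteratedDeriv 3 (z (n+1)) (compSeq z n x) = w3 at *
    generalize iteratedDeriv 4 (z (n+1)) (compSeq z n x) = w4 at *
    have hH'0 : 0 ≤ H' := by linarith
    have hgP : 0 ≤ g * P := mul_nonneg hg0 hP0
    refine ⟨?_, ?_, ?_, ?_⟩
    · rw [abs_mul, ← kk]; gcongr
    · calc |w2 * y1 ^ 2 + w1 * y2| ≤ |w2| * |y1| ^ 2 + |w1| * |y2| := by
            rw [← abs_pow, ← abs_mul, ← abs_mul]; exact abs_add_le _ _
        _ ≤ D * P' ^ 2 + β⁻¹ * (P' * H') := by gcongr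
        _ = (D * P') * P' + (β⁻¹ * P') * H' := by ring
        _ = (g * P) * P' + P * H' := by rw [key, kk]
        _ ≤ (g * P) * 1 + P * H' := by gcongr
        _ = P * H := by rw [hH]; ring
    · calc |w3 * y1 ^ 3 + 3 * w2 * y1 * y2 + w1 * y3|
          ≤ |w3| * |y1| ^ 3 + 3 * |w2| * |y1| * |y2| + |w1| * |y3| := by
            refine (abs_add_three _ _ _).trans (le_of_eq ?_)
            simp only [abs_mul, abs_pow]; norm_num
        _ ≤ D * P' ^ 3 + 3 * D * P' * (P' * H') + β⁻¹ * (3 * P' * H' ^ 2) := by gcongr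
        _ = (D * P') * (P' ^ 2 + 3 * P' * H') + 3 * (β⁻¹ * P') * H' ^ 2 := by ring
        _ = (g * P) * (P' ^ 2 + 3 * P' * H') + 3 * P * H' ^ 2 := by rw [key, kk]
        _ ≤ (g * P) * (1 ^ 2 + 3 * 1 * H') + 3 * P * H' ^ 2 := by gcongr
        _ ≤ (g * P) * (6 * H') + 3 * P * H' ^ 2 := by
            gcongr; linarith
        _ ≤ (g * P) * (6 * H') + 3 * P * H' ^ 2 + 3 * P * g ^ 2 := by
            have : 0 ≤ 3 * P * g ^ 2 := by positivity
            linarith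
        _ = 3 * P * H ^ 2 := by rw [hH]; ring
    · calc |w4 * y1 ^ 4 + 6 * w3 * y1 ^ 2 * y2 + w2 * (4 * y1 * y3 + 3 * y2 ^ 2) + w1 * y4|
          ≤ |w4| * |y1| ^ 4 + 6 * |w3| * |y1| ^ 2 * |y2|
            + |w2| * (4 * |y1| * |y3| + 3 * |y2| ^ 2) + |w1| * |y4| := by
            have h1 := abs_add_le (w4 * y1 ^ 4 + 6 * w3 * y1 ^ 2 * y2
              + w2 * (4 * y1 * y3 + 3 * y2 ^ 2)) (w1 * y4)
            have h2 := abs_add_three (w4 * y1 ^ 4) (6 * w3 * y1 ^ 2 * y2)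
              (w2 * (4 * y1 * y3 + 3 * y2 ^ 2))
            have h3 := abs_add_le (4 * y1 * y3) (3 * y2 ^ 2)
            have h4 := mul_le_mul_of_nonneg_left h3 (abs_nonneg w2)
            have e : ∀ r : ℝ, |r| = |r| := fun _ => rfl
            simp only [abs_mul, abs_pow, Nat.abs_ofNat] at h1 h2 h4
            linarith
        _ ≤ D * P' ^ 4 + 6 * D * P' ^ 2 * (P' * H')
            + D * (4 * P' * (3 * P' * H' ^ 2) + 3 * (P' * H') ^ 2)
            + β⁻¹ * (8 * P' * H' ^ 3) := by gcongr
        _ = (D * P') * (P' ^ 3 + 6 * P' ^ 2 * H' + 15 * P' * H' ^ 2)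
            + 8 * (β⁻¹ * P') * H' ^ 3 := by ring
        _ = (g * P) * (P' ^ 3 + 6 * P' ^ 2 * H' + 15 * P' * H' ^ 2)
            + 8 * P * H' ^ 3 := by rw [key, kk]
        _ ≤ (g * P) * (1 ^ 3 + 6 * 1 ^ 2 * H' + 15 * 1 * H' ^ 2)
            + 8 * P * H' ^ 3 := by gcongr
        _ ≤ (g * P) * (24 * H' ^ 2) + 8 * P * H' ^ 3 := by
            gcongr; nlinarith
        _ ≤ (g * P) * (24 * H' ^ 2) + 8 * P * H' ^ 3 + (24 * P * H' * g ^ 2 + 8 * P * g ^ 3) := by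
            have : 0 ≤ 24 * P * H' * g ^ 2 + 8 * P * g ^ 3 := by positivity
            linarith
        _ = 8 * P * H ^ 3 := by rw [hH]; ring

lemma aux_series {Ω : Type*} [MeasurableSpace Ω] (ℙ : Measure Ω)
    (h : ℕ → Ω → ℝ) (hm : ∀ k, Measurable (h k)) (h0 : ∀ k ω, 0 ≤ h k ω)
    (hi : ∀ k, Integrable (h k) ℙ) (hs : Summable fun k => ∫ ω, h k ω ∂ℙ) :
    ∃ V : Ω → ℝ, Measurable V ∧ (∀ ω, 0 ≤ V ω) ∧ Integrable V ℙ ∧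
      ∀ᵐ ω ∂ℙ, ∀ N : ℕ, ∑ k ∈ Finset.range N, h k ω ≤ V ω := by
  have hme : ∀ k, Measurable fun ω => ENNReal.ofReal (h k ω) := fun k => (hm k).ennreal_ofReal
  have hM : Measurable fun ω => ∑' k, ENNReal.ofReal (h k ω) := Measurable.ennreal_tsum hme
  have hL : ∫⁻ ω, ∑' k, ENNReal.ofReal (h k ω) ∂ℙ ≠ ⊤ := by
    rw [lintegral_tsum fun k => (hme k).aemeasurable]
    have : ∀ k, ∫⁻ ω, ENNReal.ofReal (h k ω) ∂ℙ = ENNReal.ofReal (∫ ω, h k ω ∂ℙ) := fun k =>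
      (ofReal_integral_eq_lintegral_ofReal (hi k) (Filter.Eventually.of_forall (h0 k))).symm
    simp only [this]
    exact hs.tsum_ofReal_ne_top
  refine ⟨fun ω => (∑' k, ENNReal.ofReal (h k ω)).toReal, hM.ennreal_toReal,
    fun ω => ENNReal.toReal_nonneg, integrable_toReal_of_lintegral_ne_top hM.aemeasurable hL, ?_⟩
  filter_upwards [ae_lt_top hM hL] with ω hω N
  have h1 : ∑ k ∈ Finset.range N, ENNReal.ofReal (h k ω) ≤ ∑' k, ENNReal.ofReal (h k ω) :=
    ENNReal.sum_le_tsum _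
  rw [← ENNReal.ofReal_sum_of_nonneg fun k _ => h0 k ω] at h1
  exact (ENNReal.ofReal_le_iff_le_toReal hω.ne).1 h1

lemma aux_mul {Ω : Type*} [MeasurableSpace Ω] {ℙ : Measure Ω} {X Y : Ω → ℝ} {a b t : ℝ}
    (ha : 0 < a) (hb : 0 < b) (ht : 1 / t = 1 / a + 1 / b)
    (hX : MemLpRV ℙ a X) (hY : MemLpRV ℙ b Y) : MemLpRV ℙ t (fun ω => X ω * Y ω) := by
  obtain ⟨mX, pX, iX⟩ := hX
  obtain ⟨mY, pY, iY⟩ := hY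
  have ht0 : 0 < t := by
    have : 0 < 1 / t := by rw [ht]; positivity
    exact one_div_pos.1 this
  have hsum : t / a + t / b = 1 := by
    have : t * (1 / t) = 1 := by field_simp
    rw [ht] at this
    rw [← this]; ring
  refine ⟨mX.mul mY, fun ω => mul_nonneg (pX ω) (pY ω), ?_⟩
  refine (iX.add iY).mono' ((mX.mul mY).pow_const t).aestronglyMeasurable ?_
  refine Filter.Eventually.of_forall fun ω => ?_
  have hx := pX ω
  have hy := pY ω
  have hxa := Real.rpow_nonneg hx a
  have hyb := Real.rpow_nonneg hy b
  simp only [Pi.mul_apply, Pi.add_apply]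
  rw [Real.norm_of_nonneg (Real.rpow_nonneg (mul_nonneg hx hy) _), Real.mul_rpow hx hy]
  have ex : X ω ^ t = (X ω ^ a) ^ (t / a) := by
    rw [← Real.rpow_mul hx]; congr 1; field_simp
  have ey : Y ω ^ t = (Y ω ^ b) ^ (t / b) := by
    rw [← Real.rpow_mul hy]; congr 1; field_simp
  have := Real.geom_mean_le_arith_mean2_weighted (w₁ := t / a) (w₂ := t / b)
    (by positivity) (by positivity) hxa hyb hsum
  rw [← ex, ← ey] at this
  have h1 : t / a ≤ 1 := by have : 0 < t / b := by positivity
                            linarith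
  have h2 : t / b ≤ 1 := by have : 0 < t / a := by positivity
                            linarith
  nlinarith

lemma aux_const_mul {Ω : Type*} [MeasurableSpace Ω] {ℙ : Measure Ω} {X : Ω → ℝ} {a : ℝ}
    (K : ℝ) (hK : 0 ≤ K) (hX : MemLpRV ℙ a X) : MemLpRV ℙ a (fun ω => K * X ω) := by
  obtain ⟨mX, pX, iX⟩ := hX
  refine ⟨mX.const_mul K, fun ω => mul_nonneg hK (pX ω), ?_⟩
  simp_rw [fun ω => Real.mul_rpow hK (pX ω) (z := a)]
  exact iX.const_mul _

lemma aux_max_one {Ω : Type*} [MeasurableSpace Ω] {ℙ : Measure Ω} [IsProbabilityMeasure ℙ]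
    {X : Ω → ℝ} {a : ℝ} (hX : MemLpRV ℙ a X) : MemLpRV ℙ a (fun ω => max 1 (X ω)) := by
  obtain ⟨mX, pX, iX⟩ := hX
  refine ⟨measurable_const.max mX, fun ω => zero_le_one.trans (le_max_left _ _), ?_⟩
  refine ((integrable_const 1).add iX).mono'
    ((measurable_const.max mX).pow_const a).aestronglyMeasurable ?_
  refine Filter.Eventually.of_forall fun ω => ?_
  have hxa := Real.rpow_nonneg (pX ω) a
  rw [Real.norm_of_nonneg (Real.rpow_nonneg (zero_le_one.trans (le_max_left _ _)) _)]
  simp only [Pi.add_apply]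
  rcases max_choice 1 (X ω) with h | h <;> rw [h]
  · simp; exact hxa
  · linarith

lemma aux_root {Ω : Type*} [MeasurableSpace Ω] {ℙ : Measure Ω} {V : Ω → ℝ} {a : ℝ} (ha : 0 < a)
    (mV : Measurable V) (pV : ∀ ω, 0 ≤ V ω) (iV : Integrable V ℙ) :
    MemLpRV ℙ a (fun ω => V ω ^ (1 / a)) := by
  refine ⟨mV.pow_const _, fun ω => Real.rpow_nonneg (pV ω) _, ?_⟩
  convert iV using 2 with ω
  rw [← Real.rpow_mul (pV ω), one_div, inv_mul_cancel₀ ha.ne', Real.rpow_one]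

lemma aux_sum_rpow (f : ℕ → ℝ) (hf : ∀ k, 0 ≤ f k) (s : ℝ) (hs : 0 < s) (n : ℕ) (hn : 1 ≤ n) :
    (∑ k ∈ Finset.range n, f k) ^ s
      ≤ (n : ℝ) ^ (s * max 1 (1 / s) - 1) * ∑ k ∈ Finset.range n, f k ^ s := by
  rcases le_total 1 s with h | h
  · have : 1 / s ≤ 1 := by rw [div_le_one hs]; exact h
    rw [max_eq_left this, mul_one]
    simpa using Real.rpow_sum_le_const_mul_sum_rpow_of_nonneg (s := Finset.range n) (f := f) h
      (fun i _ => hf i)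
  · have : 1 ≤ 1 / s := by rw [le_div_iff₀ hs]; linarith
    rw [max_eq_right this, mul_one_div_cancel hs.ne', sub_self, Real.rpow_zero, one_mul]
    clear hn
    induction n with
    | zero => simp [Real.zero_rpow hs.ne']
    | succ n ih =>
      rw [Finset.sum_range_succ, Finset.sum_range_succ]
      have := Real.rpow_add_le_add_rpow (Finset.sum_nonneg fun k (_ : k ∈ Finset.range n) => hf k)
        (hf n) hs.le h
      linarith

lemma aux_B {Ω : Type*} [MeasurableSpace Ω] (ℙ : Measure Ω) [IsProbabilityMeasure ℙ]
    (τ : Ω → Ω) (hτ : MeasurePreserving τ ℙ ℙ) (g : Ω → ℝ) (s : ℝ) (hs : 0 < s)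
    (hg : MemLpRV ℙ s g) (ε : ℝ) (hε : 0 < ε) :
    ∃ B : Ω → ℝ, (∀ ω, 1 ≤ B ω) ∧ MemLpRV ℙ s B ∧ ∀ᵐ ω ∂ℙ, ∀ n : ℕ, 1 ≤ n →
      1 + ∑ k ∈ Finset.range n, g (τ^[k+1] ω) ≤ B ω * (n : ℝ) ^ (max 1 (1 / s) + ε) := by
  obtain ⟨mg, pg, ig⟩ := hg
  have hmp : ∀ k, MeasurePreserving (τ^[k]) ℙ ℙ := fun k => hτ.iterate k
  obtain ⟨V, mV, pV, iV, hV⟩ := aux_series ℙ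
    (fun k ω => ((k+1 : ℕ) : ℝ) ^ (-(1 + ε * s)) * g (τ^[k+1] ω) ^ s)
    (fun k => ((mg.comp (hmp (k+1)).measurable).pow_const s).const_mul _)
    (fun k ω => mul_nonneg (by positivity) (Real.rpow_nonneg (pg _) _))
    (fun k => ((hmp (k+1)).integrable_comp_of_integrable ig).const_mul _)
    (by
      have : ∀ k : ℕ, ∫ ω, ((k+1 : ℕ) : ℝ) ^ (-(1 + ε * s)) * g (τ^[k+1] ω) ^ s ∂ℙ
          = ((k+1 : ℕ) : ℝ) ^ (-(1 + ε * s)) * ∫ ω, g ω ^ s ∂ℙ := by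
        intro k
        rw [integral_const_mul]
        congr 1
        have e := integral_map (μ := ℙ) (hmp (k+1)).measurable.aemeasurable
          (f := fun ω => g ω ^ s) (mg.pow_const s).aestronglyMeasurable
        rw [(hmp (k+1)).map_eq] at e
        exact e.symm
      simp only [this]
      refine Summable.mul_right _ ?_
      have h1 : Summable fun n : ℕ => (n : ℝ) ^ (-(1 + ε * s)) :=
        Real.summable_nat_rpow.2 (by nlinarith [mul_pos hε hs])
      exact (summable_nat_add_iff 1).2 h1)
  have hX := aux_root hs mV pV iV
  refine ⟨fun ω => 2 * max 1 (V ω ^ (1 / s)), fun ω => ?_,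
    aux_const_mul 2 (by norm_num) (aux_max_one hX), ?_⟩
  · have := le_max_left 1 (V ω ^ (1 / s)); linarith
  filter_upwards [hV] with ω hω n hn
  have hn0 : (0:ℝ) < n := by exact_mod_cast hn
  have hn1 : (1:ℝ) ≤ n := by exact_mod_cast hn
  set m := max 1 (1 / s) with hm
  have hm1 : 1 ≤ m := le_max_left _ _
  set G := ∑ k ∈ Finset.range n, g (τ^[k+1] ω) with hG
  have hG0 : 0 ≤ G := Finset.sum_nonneg fun k _ => pg _
  have h1 : G ^ s ≤ (n : ℝ) ^ (s * m - 1) * ((n : ℝ) ^ (1 + ε * s) * V ω) := by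
    refine (aux_sum_rpow _ (fun k => pg _) s hs n hn).trans ?_
    gcongr
    refine le_trans ?_ (mul_le_mul_of_nonneg_left (hω n) (by positivity))
    rw [Finset.mul_sum]
    refine Finset.sum_le_sum fun k hk => ?_
    rw [← mul_assoc]
    refine le_mul_of_one_le_left (Real.rpow_nonneg (pg _) _) ?_
    rw [Real.rpow_neg (by positivity), ← div_eq_mul_inv, one_le_div (by positivity)]
    have : k + 1 ≤ n := Finset.mem_range.1 hk
    have : ((k+1 : ℕ) : ℝ) ≤ n := by exact_mod_cast this
    gcongr
  have h2 : G ≤ V ω ^ (1 / s) * (n : ℝ) ^ (m + ε) := by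
    have h3 : G ^ s ≤ (V ω ^ (1 / s) * (n : ℝ) ^ (m + ε)) ^ s := by
      refine h1.trans (le_of_eq ?_)
      rw [Real.mul_rpow (Real.rpow_nonneg (pV ω) _) (by positivity), ← Real.rpow_mul (pV ω),
        one_div, inv_mul_cancel₀ hs.ne', Real.rpow_one, ← mul_assoc, ← Real.rpow_add hn0,
        ← Real.rpow_mul hn0.le, mul_comm]
      congr 2; ring
    exact (Real.rpow_le_rpow_iff hG0 (mul_nonneg (Real.rpow_nonneg (pV ω) _) (by positivity)) hs).1 h3
  have h4 : 1 ≤ (n : ℝ) ^ (m + ε) := Real.one_le_rpow hn1 (by linarith)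
  have h5 := le_max_left 1 (V ω ^ (1 / s))
  have h6 := le_max_right 1 (V ω ^ (1 / s))
  have h7 := mul_le_mul_of_nonneg_right h6 (zero_le_one.trans h4)
  have h8 := mul_le_mul_of_nonneg_right h5 (zero_le_one.trans h4)
  linarith

lemma aux_W {Ω : Type*} [MeasurableSpace Ω] (ℙ : Measure Ω) [IsProbabilityMeasure ℙ]
    (τ : Ω → Ω) (hτ : MeasurePreserving τ ℙ ℙ) (γ : Ω → ℝ) (hγ1 : ∀ ω, 1 ≤ γ ω)
    (a₀ q₀ : ℝ) (ha : 0 < a₀) (hq₀ : 0 < q₀)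
    (E : Ω → ℝ) (hE1 : ∀ ω, 1 ≤ E ω) (hE : MemLpRV ℙ q₀ E)
    (hdec : ∀ᵐ ω ∂ℙ, ∀ n : ℕ, 1 ≤ n →
      ∏ j ∈ Finset.range n, (γ (τ^[j+1] ω))⁻¹ ≤ E ω * (n : ℝ) ^ (-a₀)) :
    ∃ W : Ω → ℝ, (∀ ω, 1 ≤ W ω) ∧ MemLpRV ℙ (q₀ / 4) W ∧ ∀ᵐ ω ∂ℙ, ∀ n : ℕ, 1 ≤ n →
      ∏ j ∈ Finset.range n, (γ (τ^[j+1] ω))⁻¹ ≤ W ω * (n : ℝ) ^ (-(2 * a₀)) := by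
  obtain ⟨mE, pE, iE⟩ := hE
  have hmp : ∀ k, MeasurePreserving (τ^[k]) ℙ ℙ := fun k => hτ.iterate k
  have hint : ∀ k, ∫ ω, E (τ^[k] ω) ^ q₀ ∂ℙ = ∫ ω, E ω ^ q₀ ∂ℙ := by
    intro k
    have e := integral_map (μ := ℙ) (hmp k).measurable.aemeasurable
      (f := fun ω => E ω ^ q₀) (mE.pow_const q₀).aestronglyMeasurable
    rw [(hmp k).map_eq] at e
    exact e.symm
  have hinti : ∀ k, Integrable (fun ω => E (τ^[k] ω) ^ q₀) ℙ := fun k =>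
    (hmp k).integrable_comp_of_integrable iE
  obtain ⟨V, mV, pV, iV, hV⟩ := aux_series ℙ
    (fun k ω => ((2:ℝ) ^ (-(a₀ * q₀ / 2))) ^ k
      * ∑ i ∈ Finset.range 4, E (τ^[i * 2 ^ k] ω) ^ q₀)
    (fun k => (Finset.measurable_fun_sum _ fun i _ =>
      (mE.comp (hmp (i * 2 ^ k)).measurable).pow_const q₀).const_mul _)
    (fun k ω => mul_nonneg (by positivity)
      (Finset.sum_nonneg fun i _ => Real.rpow_nonneg (pE _) _))
    (fun k => (integrable_finset_sum _ fun i _ => hinti _).const_mul _)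
    (by
      have : ∀ k : ℕ, ∫ ω, ((2:ℝ) ^ (-(a₀ * q₀ / 2))) ^ k
          * ∑ i ∈ Finset.range 4, E (τ^[i * 2 ^ k] ω) ^ q₀ ∂ℙ
          = ((2:ℝ) ^ (-(a₀ * q₀ / 2))) ^ k * (4 * ∫ ω, E ω ^ q₀ ∂ℙ) := by
        intro k
        rw [integral_const_mul, integral_finset_sum _ fun i _ => hinti _]
        simp [hint]
      simp only [this]
      refine Summable.mul_right _ (summable_geometric_of_lt_one (by positivity) ?_)
      apply Real.rpow_lt_one_of_one_lt_of_neg one_lt_two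
      have : 0 < a₀ * q₀ := by positivity
      linarith)
  have hX := aux_const_mul ((8:ℝ) ^ (2 * a₀)) (by positivity)
    (aux_root (a := q₀ / 4) (by positivity) mV pV iV)
  refine ⟨_, fun ω => le_max_left _ _, aux_max_one hX, ?_⟩
  have hall : ∀ᵐ ω ∂ℙ, ∀ m : ℕ, ∀ n : ℕ, 1 ≤ n →
      ∏ j ∈ Finset.range n, (γ (τ^[j+1] (τ^[m] ω)))⁻¹ ≤ E (τ^[m] ω) * (n : ℝ) ^ (-a₀) :=
    ae_all_iff.2 fun m => (hmp m).quasiMeasurePreserving.ae hdec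
  filter_upwards [hV, hall] with ω hω hd n hn
  have hn0 : (0:ℝ) < n := by exact_mod_cast hn
  refine le_trans ?_ (mul_le_mul_of_nonneg_right (le_max_right _ _) (by positivity))
  set P : ℕ → Ω → ℝ := fun n ω => ∏ j ∈ Finset.range n, (γ (τ^[j+1] ω))⁻¹ with hPdef
  have hinv0 : ∀ ω, 0 ≤ (γ ω)⁻¹ := fun ω => inv_nonneg.2 (zero_le_one.trans (hγ1 ω))
  have P0 : ∀ n ω, 0 ≤ P n ω := fun n ω => Finset.prod_nonneg fun j _ => hinv0 _
  have P1 : ∀ n ω, P n ω ≤ 1 := fun n ω => Finset.prod_le_one (fun j _ => hinv0 _)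
    fun j _ => inv_le_one_of_one_le₀ (hγ1 _)
  have Padd : ∀ m n ω, P (m + n) ω = P m ω * P n (τ^[m] ω) := by
    intro m n ω
    simp only [hPdef]
    rw [Finset.prod_range_add]
    congr 1
    refine Finset.prod_congr rfl fun j _ => ?_
    rw [← Function.iterate_add_apply]
    rw [show m + j + 1 = j + 1 + m by omega]
  change P n ω ≤ _
  have hexp : 1 / (q₀ / 4) = 4 / q₀ := by field_simp
  rw [hexp]
  have hterm : ∀ k, ((2:ℝ) ^ (-(a₀ * q₀ / 2))) ^ k
      * ∑ i ∈ Finset.range 4, E (τ^[i * 2 ^ k] ω) ^ q₀ ≤ V ω := by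
    intro k
    refine le_trans ?_ (hω (k+1))
    exact Finset.single_le_sum (f := fun k => ((2:ℝ) ^ (-(a₀ * q₀ / 2))) ^ k
      * ∑ i ∈ Finset.range 4, E (τ^[i * 2 ^ k] ω) ^ q₀) (fun k _ => mul_nonneg (by positivity)
      (Finset.sum_nonneg fun i _ => Real.rpow_nonneg (pE _) _)) (Finset.self_mem_range_succ k)
  have hsingle : ∀ k, ∀ i < 4, E (τ^[i * 2 ^ k] ω) ^ 4
      ≤ V ω ^ (4 / q₀) * ((2:ℝ) ^ k) ^ (2 * a₀) := by
    intro k i hi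
    have h1 : ((2:ℝ) ^ (-(a₀ * q₀ / 2))) ^ k * E (τ^[i * 2 ^ k] ω) ^ q₀ ≤ V ω := by
      refine le_trans ?_ (hterm k)
      refine mul_le_mul_of_nonneg_left ?_ (by positivity)
      exact Finset.single_le_sum (f := fun i => E (τ^[i * 2 ^ k] ω) ^ q₀)
        (fun i _ => Real.rpow_nonneg (pE _) _) (Finset.mem_range.2 hi)
    have e1 : ((2:ℝ) ^ (-(a₀ * q₀ / 2))) ^ k = (((2:ℝ) ^ k) ^ (a₀ * q₀ / 2))⁻¹ := by
      rw [← Real.rpow_natCast, ← Real.rpow_natCast, ← Real.rpow_mul (by norm_num),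
        ← Real.rpow_mul (by norm_num), ← Real.rpow_neg (by norm_num)]
      congr 1; ring
    rw [e1, inv_mul_le_iff₀ (by positivity)] at h1
    have h2 := Real.rpow_le_rpow (Real.rpow_nonneg (pE _) _) h1 (z := 4 / q₀) (by positivity)
    rw [← Real.rpow_mul (pE _), Real.mul_rpow (by positivity) (pV ω),
      ← Real.rpow_mul (by positivity)] at h2
    have e2 : q₀ * (4 / q₀) = (4:ℕ) := by push_cast; field_simp
    have e3 : a₀ * q₀ / 2 * (4 / q₀) = 2 * a₀ := by field_simp; norm_num
    rw [e2, e3, Real.rpow_natCast] at h2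
    linarith
  rcases lt_or_ge n 4 with h4 | h4
  · refine (P1 n ω).trans ?_
    have h1 := hsingle 0 0 (by norm_num)
    simp only [pow_zero, Real.one_rpow, mul_one, zero_mul, Function.iterate_zero, id] at h1
    have h2 : 1 ≤ V ω ^ (4 / q₀) := (one_le_pow₀ (hE1 ω)).trans h1
    have h3 : 1 ≤ (8:ℝ) ^ (2 * a₀) * (n : ℝ) ^ (-(2 * a₀)) := by
      rw [Real.rpow_neg hn0.le, ← div_eq_mul_inv, one_le_div (by positivity)]
      have : (n:ℝ) ≤ 8 := by
        have : n ≤ 8 := by omega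
        exact_mod_cast this
      gcongr
    calc (1:ℝ) ≤ V ω ^ (4 / q₀) * ((8:ℝ) ^ (2 * a₀) * (n : ℝ) ^ (-(2 * a₀))) :=
          one_le_mul_of_one_le_of_one_le h2 h3
      _ = _ := by ring
  · obtain ⟨k, hk1, hk2⟩ : ∃ k, 4 * 2 ^ k ≤ n ∧ n ≤ 8 * 2 ^ k := by
      refine ⟨Nat.log 2 n - 2, ?_, ?_⟩
      · have h1 := Nat.pow_log_le_self 2 (x := n) (by omega)
        have h2 : 2 ≤ Nat.log 2 n := Nat.le_log_of_pow_le (by norm_num) (by omega)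
        calc 4 * 2 ^ (Nat.log 2 n - 2) = 2 ^ (2 + (Nat.log 2 n - 2)) := by rw [pow_add]; norm_num
          _ = 2 ^ (Nat.log 2 n) := by congr 1; omega
          _ ≤ n := h1
      · have h1 := (Nat.lt_pow_succ_log_self (b := 2) (by norm_num) n).le
        have h2 : 2 ≤ Nat.log 2 n := Nat.le_log_of_pow_le (by norm_num) (by omega)
        calc n ≤ 2 ^ (Nat.log 2 n + 1) := h1
          _ = 2 ^ (3 + (Nat.log 2 n - 2)) := by congr 1; omega
          _ = 8 * 2 ^ (Nat.log 2 n - 2) := by rw [pow_add]; norm_num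
    have hN1 : 1 ≤ 2 ^ k := Nat.one_le_two_pow
    have hcast : (((2 ^ k : ℕ)) : ℝ) = (2:ℝ) ^ k := by push_cast; rfl
    have hq : ∀ i, P (2 ^ k) (τ^[i * 2 ^ k] ω) ≤ E (τ^[i * 2 ^ k] ω) * ((2:ℝ) ^ k) ^ (-a₀) := by
      intro i
      have := hd (i * 2 ^ k) (2 ^ k) hN1
      rw [hcast] at this
      exact this
    set N := 2 ^ k with hN
    set x : ℝ := (2:ℝ) ^ k with hx
    have hx0 : 0 < x := by positivity
    obtain ⟨i, hi, hmax⟩ := Finset.exists_max_image (Finset.range 4)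
      (fun i => E (τ^[i * N] ω)) ⟨0, by simp⟩
    have hM := hsingle k i (Finset.mem_range.1 hi)
    set M := E (τ^[i * N] ω) with hMdef
    have hM0 : 0 ≤ M := pE _
    have hq' : ∀ i < 4, P N (τ^[i * N] ω) ≤ M * x ^ (-a₀) := fun i hi =>
      (hq i).trans (mul_le_mul_of_nonneg_right (hmax i (Finset.mem_range.2 hi)) (by positivity))
    have e4 : P n ω ≤ P (N + (N + (N + N))) ω := by
      have : n = N + (N + (N + N)) + (n - 4 * N) := by omega
      rw [this, Padd]
      exact mul_le_of_le_one_right (P0 _ _) (P1 _ _)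
    rw [Padd, Padd, Padd] at e4
    simp only [← Function.iterate_add_apply] at e4
    have q0 := hq' 0 (by norm_num)
    have q1 := hq' 1 (by norm_num)
    have q2 := hq' 2 (by norm_num)
    have q3 := hq' 3 (by norm_num)
    rw [zero_mul, Function.iterate_zero, id] at q0
    rw [one_mul] at q1
    rw [show 2 * N = N + N by ring] at q2
    rw [show 3 * N = N + (N + N) by ring] at q3
    have a0 := P0 N ω
    have a1 := P0 N (τ^[N] ω)
    have a2 := P0 N (τ^[N + N] ω)
    have a3 := P0 N (τ^[N + (N + N)] ω)
    have hMx : 0 ≤ M * x ^ (-a₀) := by positivity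
    have e5 : P n ω ≤ (M * x ^ (-a₀)) * ((M * x ^ (-a₀)) * ((M * x ^ (-a₀)) * (M * x ^ (-a₀)))) := by
      refine e4.trans ?_
      gcongr <;> assumption
    have e6 : (x ^ (-a₀)) ^ 4 = x ^ (-(2 * a₀)) * x ^ (-(2 * a₀)) := by
      rw [← Real.rpow_natCast, ← Real.rpow_mul hx0.le, ← Real.rpow_add hx0]
      congr 1; push_cast; ring
    have e7 : x ^ (2 * a₀) * x ^ (-(2 * a₀)) = 1 := by
      rw [← Real.rpow_add hx0]; simp
    have e8 : x ^ (-(2 * a₀)) ≤ (8:ℝ) ^ (2 * a₀) * (n : ℝ) ^ (-(2 * a₀)) := by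
      rw [Real.rpow_neg hn0.le, Real.rpow_neg hx0.le, ← div_eq_mul_inv,
        inv_le_iff_one_le_mul₀ (by positivity), div_mul_eq_mul_div, one_le_div (by positivity),
        ← Real.mul_rpow (by norm_num) hx0.le]
      have : (n:ℝ) ≤ 8 * x := by rw [← hcast]; exact_mod_cast hk2
      gcongr
    calc P n ω ≤ M ^ 4 * (x ^ (-a₀)) ^ 4 := by refine e5.trans (le_of_eq (by ring))
      _ ≤ (V ω ^ (4 / q₀) * x ^ (2 * a₀)) * (x ^ (-(2 * a₀)) * x ^ (-(2 * a₀))) := by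
          rw [e6]; gcongr
      _ = V ω ^ (4 / q₀) * (x ^ (2 * a₀) * x ^ (-(2 * a₀))) * x ^ (-(2 * a₀)) := by ring
      _ = V ω ^ (4 / q₀) * x ^ (-(2 * a₀)) := by rw [e7, mul_one]
      _ ≤ V ω ^ (4 / q₀) * ((8:ℝ) ^ (2 * a₀) * (n : ℝ) ^ (-(2 * a₀))) := by
          have := Real.rpow_nonneg (pV ω) (4 / q₀)
          gcongr
      _ = _ := by ring

lemma aux_final (n : ℕ) (hn : 1 ≤ n) (m : ℕ) (K P H F B a θ e : ℝ) (hK : 0 ≤ K)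
    (hP0 : 0 ≤ P) (hH0 : 0 ≤ H) (hB0 : 0 ≤ B)
    (hP : P ≤ F * (n : ℝ) ^ (-a)) (hH : H ≤ B * (n : ℝ) ^ θ) (he : -a + θ * m ≤ e) :
    K * P * H ^ m ≤ K * (F * B ^ m) * (n : ℝ) ^ e := by
  have hn0 : (0:ℝ) < n := by exact_mod_cast hn
  have hn1 : (1:ℝ) ≤ n := by exact_mod_cast hn
  have hF : 0 ≤ F * (n : ℝ) ^ (-a) := hP0.trans hP
  have hF0 : 0 ≤ F := nonneg_of_mul_nonneg_left hF (by positivity)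
  calc K * P * H ^ m ≤ K * (F * (n : ℝ) ^ (-a)) * (B * (n : ℝ) ^ θ) ^ m := by gcongr
    _ = K * (F * B ^ m) * (n : ℝ) ^ (-a + θ * m) := by
        rw [mul_pow, ← Real.rpow_natCast ((n:ℝ) ^ θ), ← Real.rpow_mul hn0.le, Real.rpow_add hn0]
        ring
    _ ≤ _ := by gcongr

theorem stmt_8
    {Ω : Type*} [MeasurableSpace Ω] (ℙ : Measure Ω) [IsProbabilityMeasure ℙ]
    (σ σinv : Ω → Ω)
    (hσ : MeasurePreserving σ ℙ ℙ) (hσinv : Measurable σinv)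
    (hinv₁ : Function.LeftInverse σinv σ) (hinv₂ : Function.RightInverse σinv σ)
    (γ : Ω → ℝ) (hγ1 : ∀ ω, 1 ≤ γ ω) (q : ℝ) (hq : 1 < q) (hγq : MemLpRV ℙ q γ)
    (c : Ω → ℝ) (p : ℝ) (hp : 1 < p) (hc : MemLpRV ℙ p c)
    -- the decay condition
    (a₀ q₀ : ℝ) (ha₀pos : 0 < a₀) (hq₀ : 0 < q₀)
    (E : Ω → ℝ) (hE1 : ∀ ω, 1 ≤ E ω) (hE : MemLpRV ℙ q₀ E)
    (hdecay : ∀ᵐ ω ∂ℙ, ∀ n : ℕ, 1 ≤ n →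
      max (∏ j ∈ Finset.range n, (γ (σ^[j] ω))⁻¹)
          (∏ j ∈ Finset.Ico 1 n, (γ (σinv^[j] ω))⁻¹) ≤ E ω * (n : ℝ) ^ (-a₀))
    (ha₀ : 1 + 1 / p + 1 / q < a₀)
    (s t u u₁ : ℝ)
    (hs : 1 / s = 1 / p + 1 / q)
    (ht : 1 / t = 1 / q₀ + 1 / p + 1 / q)
    (hu : 1 / u = 1 / q₀ + 2 / p + 2 / q)
    (hu₁ : 1 / u₁ = 4 / q₀ + 3 / s) :
    ∃ δ₀ : ℝ, 0 < δ₀ ∧ ∀ δ : ℝ, 0 < δ → δ ≤ δ₀ →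
      (∃ C : Ω → ℝ, (∀ ω, 1 ≤ C ω) ∧ MemLpRV ℙ t C ∧
        ∀ᵐ ω ∂ℙ, ∀ n : ℕ, 1 ≤ n → ∀ z : ℕ → ℝ → ℝ,
          (∀ j, 1 ≤ j → j ≤ n → ContDiff ℝ 4 (z j)) →
          (∀ j, 1 ≤ j → j ≤ n → ∀ x : ℝ,
            |deriv (z j) x| ≤ (γ (σinv^[j] ω))⁻¹ ∧
            |iteratedDeriv 2 (z j) x| ≤ c (σinv^[j] ω) ∧
            |iteratedDeriv 3 (z j) x| ≤ c (σinv^[j] ω) ∧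
            |iteratedDeriv 4 (z j) x| ≤ c (σinv^[j] ω)) →
          ∀ x : ℝ,
            |iteratedDeriv 2 (compSeq z n) x| ≤ C ω * (n : ℝ) ^ (-(a₀ - 1 - 1 / s - δ))) ∧
      (a₀ > 2 + 1 / s →
        ∃ A : Ω → ℝ, (∀ ω, 1 ≤ A ω) ∧ MemLpRV ℙ u A ∧
          ∀ᵐ ω ∂ℙ, ∀ n : ℕ, 1 ≤ n → ∀ z : ℕ → ℝ → ℝ,
            (∀ j, 1 ≤ j → j ≤ n → ContDiff ℝ 4 (z j)) →
            (∀ j, 1 ≤ j → j ≤ n → ∀ x : ℝ,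
              |deriv (z j) x| ≤ (γ (σinv^[j] ω))⁻¹ ∧
              |iteratedDeriv 2 (z j) x| ≤ c (σinv^[j] ω) ∧
              |iteratedDeriv 3 (z j) x| ≤ c (σinv^[j] ω) ∧
              |iteratedDeriv 4 (z j) x| ≤ c (σinv^[j] ω)) →
            ∀ x : ℝ,
              |iteratedDeriv 3 (compSeq z n) x| ≤
                A ω * (n : ℝ) ^ (-(a₀ - 2 - 1 / s - δ))) ∧
      (2 * a₀ > 3 - 2 / s →
        ∃ R : Ω → ℝ, (∀ ω, 1 ≤ R ω) ∧ MemLpRV ℙ u₁ R ∧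
          ∀ᵐ ω ∂ℙ, ∀ n : ℕ, 1 ≤ n → ∀ z : ℕ → ℝ → ℝ,
            (∀ j, 1 ≤ j → j ≤ n → ContDiff ℝ 4 (z j)) →
            (∀ j, 1 ≤ j → j ≤ n → ∀ x : ℝ,
              |deriv (z j) x| ≤ (γ (σinv^[j] ω))⁻¹ ∧
              |iteratedDeriv 2 (z j) x| ≤ c (σinv^[j] ω) ∧
              |iteratedDeriv 3 (z j) x| ≤ c (σinv^[j] ω) ∧
              |iteratedDeriv 4 (z j) x| ≤ c (σinv^[j] ω)) →
            ∀ x : ℝ,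
              |iteratedDeriv 4 (compSeq z n) x| ≤
                R ω * (n : ℝ) ^ (-(2 * a₀ - 3 - 3 / s - δ))) := by
  have hp0 : 0 < p := by linarith
  have hq0 : 0 < q := by linarith
  have hs0 : 0 < s := by
    have : 0 < 1 / s := by rw [hs]; positivity
    exact one_div_pos.1 this
  have hs2 : 1 / s ≤ 2 := by
    have h1 : 1 / p ≤ 1 := by rw [div_le_one hp0]; exact hp.le
    have h2 : 1 / q ≤ 1 := by rw [div_le_one hq0]; exact hq.le
    rw [hs]; linarith
  have hs1 : 0 < 1 / s := one_div_pos.2 hs0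
  have hτ : MeasurePreserving σinv ℙ ℙ := by
    refine ⟨hσinv, ?_⟩
    conv_lhs => rw [← hσ.map_eq]
    rw [Measure.map_map hσinv hσ.measurable, hinv₁.comp_eq_id, Measure.map_id]
  have hg : MemLpRV ℙ s (fun ω => c ω * γ ω) := aux_mul hp0 hq0 hs hc hγq
  have hdec : ∀ᵐ ω ∂ℙ, ∀ n : ℕ, 1 ≤ n →
      ∏ j ∈ Finset.range n, (γ (σinv^[j+1] ω))⁻¹ ≤ E ω * (n : ℝ) ^ (-a₀) := by
    filter_upwards [hdecay] with ω hω n hn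
    have h1 := (le_max_right _ _).trans (hω (n+1) (by omega))
    rw [Finset.prod_Ico_eq_prod_range] at h1
    simp only [Nat.add_sub_cancel, add_comm 1] at h1
    refine h1.trans ?_
    have hn0 : (0:ℝ) < n := by exact_mod_cast hn
    refine mul_le_mul_of_nonneg_left ?_ (zero_le_one.trans (hE1 ω))
    exact Real.rpow_le_rpow_of_nonpos hn0 (by push_cast; linarith) (by linarith)
  obtain ⟨W, hW1, hW, hWd⟩ := aux_W ℙ σinv hτ γ hγ1 a₀ q₀ ha₀pos hq₀ E hE1 hE hdec
  refine ⟨1, one_pos, fun δ hδ _ => ?_⟩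
  obtain ⟨B, hB1, hB, hBd⟩ := aux_B ℙ σinv hτ _ s hs0 hg (δ / 3) (by positivity)
  have hm1 : max 1 (1 / s) ≤ 1 + 1 / s := max_le (by linarith) (by linarith)
  have hm2 : 2 * max 1 (1 / s) ≤ 2 + 1 / s := by
    rcases max_choice 1 (1 / s) with h | h <;> rw [h] <;> linarith
  have hP0 : ∀ ω n, 0 ≤ ∏ j ∈ Finset.range n, (γ (σinv^[j+1] ω))⁻¹ := fun ω n =>
    Finset.prod_nonneg fun j _ => inv_nonneg.2 (zero_le_one.trans (hγ1 _))
  have hH0 : ∀ ω n, 0 ≤ 1 + ∑ j ∈ Finset.range n, c (σinv^[j+1] ω) * γ (σinv^[j+1] ω) :=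
    fun ω n => add_nonneg zero_le_one (Finset.sum_nonneg fun j _ =>
      mul_nonneg (hc.2.1 _) (zero_le_one.trans (hγ1 _)))
  have hB0 : ∀ ω, 0 ≤ B ω := fun ω => zero_le_one.trans (hB1 ω)
  have hpw : ∀ m ω, 1 ≤ B ω ^ m := fun m ω => one_le_pow₀ (hB1 ω)
  have hBB : MemLpRV ℙ (s / 2) (fun ω => B ω * B ω) :=
    aux_mul hs0 hs0 (by field_simp; norm_num) hB hB
  have hBBB : MemLpRV ℙ (s / 3) (fun ω => B ω * (B ω * B ω)) :=
    aux_mul hs0 (by positivity) (by field_simp; norm_num) hB hBB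
  refine ⟨?_, fun _ => ?_, fun _ => ?_⟩
  · refine ⟨fun ω => 1 * (E ω * B ω ^ 1), fun ω => ?_, ?_, ?_⟩
    · have := one_le_mul_of_one_le_of_one_le (hE1 ω) (hpw 1 ω)
      linarith
    · have := aux_mul hq₀ hs0 (by rw [ht, hs]; ring) hE hB (t := t)
      simpa using this
    · filter_upwards [hdec, hBd] with ω h1 h2 n hn z hz hzb x
      obtain ⟨-, b2, -, -⟩ := aux_bounds z n (fun j => γ (σinv^[j] ω)) (fun j => c (σinv^[j] ω))
        (fun j => hγ1 _) (fun j => hc.2.1 _) hz hzb x _ _ rfl rfl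
      refine le_trans (b2.trans (le_of_eq ?_)) (aux_final n hn 1 1 _ _ _ _ a₀ _ _ zero_le_one
        (hP0 ω n) (hH0 ω n) (hB0 ω) (h1 n hn) (h2 n hn) ?_)
      · ring
      · push_cast; linarith
  · refine ⟨fun ω => 3 * (E ω * B ω ^ 2), fun ω => ?_, ?_, ?_⟩
    · have := one_le_mul_of_one_le_of_one_le (hE1 ω) (hpw 2 ω)
      linarith
    · have e : 1 / u = 1 / q₀ + 1 / (s / 2) := by
        rw [hu, one_div_div, ← mul_one_div 2 s, hs]; ring
      have := aux_const_mul 3 (by norm_num) (aux_mul hq₀ (by positivity) e hE hBB)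
      simpa only [pow_two] using this
    · filter_upwards [hdec, hBd] with ω h1 h2 n hn z hz hzb x
      obtain ⟨-, -, b3, -⟩ := aux_bounds z n (fun j => γ (σinv^[j] ω)) (fun j => c (σinv^[j] ω))
        (fun j => hγ1 _) (fun j => hc.2.1 _) hz hzb x _ _ rfl rfl
      refine le_trans b3 (aux_final n hn 2 3 _ _ _ _ a₀ _ _ (by norm_num)
        (hP0 ω n) (hH0 ω n) (hB0 ω) (h1 n hn) (h2 n hn) ?_)
      push_cast; linarith
  · refine ⟨fun ω => 8 * (W ω * B ω ^ 3), fun ω => ?_, ?_, ?_⟩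
    · have := one_le_mul_of_one_le_of_one_le (hW1 ω) (hpw 3 ω)
      linarith
    · have e : 1 / u₁ = 1 / (q₀ / 4) + 1 / (s / 3) := by
        rw [hu₁, one_div_div, one_div_div]
      have := aux_const_mul 8 (by norm_num)
        (aux_mul (by positivity) (by positivity) e hW hBBB)
      have e3 : ∀ ω, B ω ^ 3 = B ω * (B ω * B ω) := fun ω => by ring
      simpa only [e3] using this
    · filter_upwards [hWd, hBd] with ω h1 h2 n hn z hz hzb x
      obtain ⟨-, -, -, b4⟩ := aux_bounds z n (fun j => γ (σinv^[j] ω)) (fun j => c (σinv^[j] ω))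
        (fun j => hγ1 _) (fun j => hc.2.1 _) hz hzb x _ _ rfl rfl
      refine le_trans b4 (aux_final n hn 3 8 _ _ _ _ (2 * a₀) _ _ (by norm_num)
        (hP0 ω n) (hH0 ω n) (hB0 ω) (h1 n hn) (h2 n hn) ?_)
      have : 3 / s = 3 * (1 / s) := by ring
      push_cast; linarith
end
end
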